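/- arXiv:2007.07946 — 6 statements merged into one kernel-verified Lean document; each statement's English description precedes it below -/
import Mathlib

section
/- Let g : [0,∞) → (0,∞) be continuously differentiable with lim_{x→∞} g(x) = +∞ and sup_{x>0} |g′(x)/g(x)| ≤ C for some constant C < ∞. Then for every κ > 0, the limit lim_{x→∞} [ g(x) · ∫₀ˣ exp(κ ∫₀ˢ g(u) du) ds ] / exp(κ ∫₀ˣ g(u) du) = 1/κ holds; in particular there exist x₀ > 0 and constants 0 < c̄ ≤ C̄ < ∞ such that for all x > x₀, c̄ ≤ g(x) · ∫₀ˣ exp(κ ∫₀ˢ g(u) du) ds / exp(κ ∫₀ˣ g(u) du) ≤ C̄. -/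
open MeasureTheory ProbabilityTheory Real Filter Set

/-- `Aint α t = ∫₀ᵗ α(u) du`. -/
noncomputable def Aint (α : ℝ → ℝ) (t : ℝ) : ℝ := ∫ u in (0:ℝ)..t, α u

/-- `alphaStar α t = sup_{0 ≤ r ≤ t} α(r)`. -/
noncomputable def alphaStar (α : ℝ → ℝ) (t : ℝ) : ℝ := sSup (α '' Set.Icc 0 t)

/-- Covariance kernel of the infinite time horizon Brownian bridge. -/
noncomputable def Kker (α : ℝ → ℝ) (s t : ℝ) : ℝ :=
  Real.exp (-(Aint α s) - Aint α t) * ∫ u in (0:ℝ)..(min s t), Real.exp (2 * Aint α u)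

/-- `X` is an infinite time horizon Brownian bridge associated with coefficient `α`:
every finite real linear combination of the `X_{t_i}` (for `t_i ≥ 0`) is a centered
Gaussian random variable, and the covariance is given by the kernel `Kker α`. -/
def IsBridge {Ω : Type*} [MeasurableSpace Ω] (P : Measure Ω) (α : ℝ → ℝ)
    (X : ℝ → Ω → ℝ) : Prop :=
  (∀ (n : ℕ) (c t : Fin n → ℝ), (∀ i, 0 ≤ t i) →
    ∃ v : NNReal, P.map (fun ω => ∑ i, c i * X (t i) ω) = gaussianReal 0 v) ∧
  (∀ s t : ℝ, 0 ≤ s → 0 ≤ t → ∫ ω, X s ω * X t ω ∂P = Kker α s t)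

/-- Growth conditions (i) and (ii) on `α`, with parameters `γ ∈ [0,1/2]`, `β > 0`. -/
def GrowthCond (α : ℝ → ℝ) (γ β : ℝ) : Prop :=
  ContDiffOn ℝ 1 α (Set.Ici 0) ∧ γ ∈ Set.Icc (0:ℝ) (1/2) ∧ 0 < β ∧
    (∃ C > (0:ℝ), ∀ t > (0:ℝ), (alphaStar α (t+1)) ^ (2*γ) / α t ≤ C * t ^ (-β)) ∧
    (∃ C : ℝ, ∀ t ≥ (0:ℝ), |deriv α t / α t| ≤ C)

/-- The approximating local time `L^x_{t,ε} = ∫₀ᵗ (2πε)^{-1/2} exp(-(X_r - x)²/(2ε)) dr`. -/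
noncomputable def locApprox {Ω : Type*} (X : ℝ → Ω → ℝ) (x ε t : ℝ) (ω : Ω) : ℝ :=
  ∫ r in (0:ℝ)..t, (Real.sqrt (2 * Real.pi * ε))⁻¹ * Real.exp (-(X r ω - x)^2 / (2*ε))

/-- A function whose derivative is negligible against the derivative of a function tending to
infinity is itself negligible against that function. -/
lemma tendsto_div_zero_of_deriv_le {D I D' I' : ℝ → ℝ} (hI : Tendsto I atTop atTop)
    (hD' : ∀ x > 0, HasDerivAt D (D' x) x) (hI' : ∀ x > 0, HasDerivAt I (I' x) x)
    (hle : ∀ ε > 0, ∀ᶠ x in atTop, |D' x| ≤ ε * I' x) :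
    Tendsto (fun x => D x / I x) atTop (nhds 0) := by
  rw [Metric.tendsto_nhds]
  intro ε hε
  obtain ⟨a, ha⟩ := eventually_atTop.1 (hle (ε / 2) (half_pos hε))
  set b := max a 1
  have hb0 : 0 < b := lt_max_of_lt_right one_pos
  have hpos : ∀ x ∈ Ici b, 0 < x := fun x hx => hb0.trans_le hx
  have hsub (x : ℝ) (hx : x ∈ Ici b) :
      HasDerivAt (fun y => ε / 2 * I y - D y) (ε / 2 * I' x - D' x) x :=
    ((hI' x (hpos x hx)).const_mul _).sub (hD' x (hpos x hx))
  have hadd (x : ℝ) (hx : x ∈ Ici b) :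
      HasDerivAt (fun y => ε / 2 * I y + D y) (ε / 2 * I' x + D' x) x :=
    ((hI' x (hpos x hx)).const_mul _).add (hD' x (hpos x hx))
  have hmono_sub : MonotoneOn (fun y => ε / 2 * I y - D y) (Ici b) := by
    refine monotoneOn_of_hasDerivWithinAt_nonneg (convex_Ici b)
      (fun x hx => (hsub x hx).continuousAt.continuousWithinAt)
      (fun x hx => (hsub x (interior_subset hx)).hasDerivWithinAt) fun x hx => ?_
    have := ha x ((le_max_left a 1).trans (interior_subset hx))
    linarith [le_abs_self (D' x)]
  have hmono_add : MonotoneOn (fun y => ε / 2 * I y + D y) (Ici b) := by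
    refine monotoneOn_of_hasDerivWithinAt_nonneg (convex_Ici b)
      (fun x hx => (hadd x hx).continuousAt.continuousWithinAt)
      (fun x hx => (hadd x (interior_subset hx)).hasDerivWithinAt) fun x hx => ?_
    have := ha x ((le_max_left a 1).trans (interior_subset hx))
    linarith [neg_abs_le (D' x)]
  filter_upwards [hI.eventually_gt_atTop 0, eventually_ge_atTop b,
    hI.eventually_gt_atTop ((|D b| + ε / 2 * |I b|) / (ε / 2))] with x hx0 hxb hx
  rw [div_lt_iff₀ (half_pos hε)] at hx
  have h1 := hmono_sub (mem_Ici.2 le_rfl) hxb hxb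
  have h2 := hmono_add (mem_Ici.2 le_rfl) hxb hxb
  have h3 : -(ε / 2 * |I b|) ≤ ε / 2 * I b := by nlinarith [neg_abs_le (I b)]
  simp only at h1 h2
  rw [Real.dist_eq, sub_zero, abs_div, abs_of_pos hx0, div_lt_iff₀ hx0, abs_lt]
  constructor <;> linarith [neg_abs_le (D b), le_abs_self (D b)]

lemma continuousOn_primitive_Ici {h : ℝ → ℝ} (hh : ContinuousOn h (Ici 0)) :
    ContinuousOn (fun x => ∫ u in (0:ℝ)..x, h u) (Ici 0) := by
  have hc : Continuous fun u => h (max u 0) :=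
    hh.comp_continuous (by fun_prop) fun u => le_max_right u 0
  refine (intervalIntegral.continuous_primitive (μ := volume)
    (fun a b => hc.intervalIntegrable a b) 0).continuousOn.congr fun x hx => ?_
  refine intervalIntegral.integral_congr fun u hu => ?_
  rw [uIcc_of_le hx] at hu
  simp [max_eq_left hu.1]

lemma hasDerivAt_primitive_of_continuousOn_Ici {h : ℝ → ℝ} (hh : ContinuousOn h (Ici 0))
    {x : ℝ} (hx : 0 < x) : HasDerivAt (fun y => ∫ u in (0:ℝ)..y, h u) (h x) x := by
  have hint : IntervalIntegrable h volume 0 x :=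
    (hh.mono (by rw [uIcc_of_le hx.le]; exact Icc_subset_Ici_self)).intervalIntegrable
  exact intervalIntegral.integral_hasDerivAt_right hint
    ((hh.mono Ioi_subset_Ici_self).stronglyMeasurableAtFilter isOpen_Ioi x hx)
    (hh.continuousAt (Ici_mem_nhds hx))

lemma tendsto_mul_integral_exp_div_exp {g : ℝ → ℝ}
    (hg_pos : ∀ x ≥ (0:ℝ), 0 < g x)
    (hg_smooth : ContDiffOn ℝ 1 g (Ici 0))
    (hg_tendsto : Tendsto g atTop atTop)
    (hg_ratio : ∃ C : ℝ, ∀ x > (0:ℝ), |deriv g x / g x| ≤ C) {κ : ℝ} (hκ : 0 < κ) :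
    Tendsto (fun x : ℝ =>
      g x * (∫ s in (0:ℝ)..x, Real.exp (κ * ∫ u in (0:ℝ)..s, g u)) /
        Real.exp (κ * ∫ u in (0:ℝ)..x, g u)) atTop (nhds (1 / κ)) := by
  obtain ⟨C, hC⟩ := hg_ratio
  set E : ℝ → ℝ := fun s => Real.exp (κ * ∫ u in (0:ℝ)..s, g u)
  set I : ℝ → ℝ := fun x => ∫ s in (0:ℝ)..x, E s
  have hE_pos (x : ℝ) : 0 < E x := Real.exp_pos _
  have hE_cont : ContinuousOn E (Ici 0) :=
    Real.continuous_exp.comp_continuousOn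
      (continuousOn_const.mul (continuousOn_primitive_Ici hg_smooth.continuousOn))
  have hE_one (x : ℝ) (hx : 0 ≤ x) : 1 ≤ E x :=
    Real.one_le_exp (mul_nonneg hκ.le
      (intervalIntegral.integral_nonneg hx fun u hu => (hg_pos u hu.1).le))
  have hE_deriv (x : ℝ) (hx : 0 < x) : HasDerivAt E (E x * (κ * g x)) x :=
    ((hasDerivAt_primitive_of_continuousOn_Ici hg_smooth.continuousOn hx).const_mul κ).exp
  have hI_deriv (x : ℝ) (hx : 0 < x) : HasDerivAt I (E x) x :=
    hasDerivAt_primitive_of_continuousOn_Ici hE_cont hx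
  have hI_ge (x : ℝ) (hx : 0 ≤ x) : x ≤ I x := by
    have h : ∫ _ in (0:ℝ)..x, (1:ℝ) ≤ I x :=
      intervalIntegral.integral_mono_on hx intervalIntegrable_const
        ((hE_cont.mono (by rw [uIcc_of_le hx]; exact Icc_subset_Ici_self)).intervalIntegrable)
        fun u hu => hE_one u hu.1
    simpa using h
  have hI_tendsto : Tendsto I atTop atTop :=
    tendsto_atTop_mono' _ ((eventually_ge_atTop 0).mono hI_ge) tendsto_id
  have hg_deriv (x : ℝ) (hx : 0 < x) : HasDerivAt g (deriv g x) x :=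
    ((hg_smooth.contDiffAt (Ici_mem_nhds hx)).differentiableAt one_ne_zero).hasDerivAt
  have hD : Tendsto (fun x => (E x / g x - κ * I x) / I x) atTop (nhds 0) := by
    refine tendsto_div_zero_of_deriv_le hI_tendsto
      (fun x hx => ((hE_deriv x hx).div (hg_deriv x hx) (hg_pos x hx.le).ne').sub
        ((hI_deriv x hx).const_mul κ)) hI_deriv fun ε hε => ?_
    filter_upwards [eventually_gt_atTop 0, hg_tendsto.eventually_ge_atTop (C / ε)] with x hx hgx
    have hg0 := hg_pos x hx.le
    have heq : (E x * (κ * g x) * g x - E x * deriv g x) / g x ^ 2 - κ * E x =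
        -(deriv g x / g x / g x * E x) := by
      field_simp
      ring
    rw [heq, abs_neg, abs_mul, abs_div _ (g x), abs_of_pos (hE_pos x), abs_of_pos hg0]
    gcongr
    rw [div_le_iff₀ hg0]
    rw [div_le_iff₀ hε] at hgx
    linarith [hC x hx]
  have hlim : Tendsto (fun x => ((E x / g x - κ * I x) / I x + κ)⁻¹) atTop (nhds (1 / κ)) := by
    simpa using (hD.add_const κ).inv₀ (by simpa using hκ.ne')
  refine hlim.congr' ?_
  filter_upwards [eventually_gt_atTop 0] with x hx
  have hI0 : 0 < I x := hx.trans_le (hI_ge x hx.le)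
  have hg0 := hg_pos x hx.le
  have hE0 := hE_pos x
  have heq : (E x / g x - κ * I x) / I x + κ = E x / (g x * I x) := by
    field_simp
    ring
  rw [heq, inv_div]

theorem stmt_0 (g : ℝ → ℝ)
    (hg_pos : ∀ x ≥ (0:ℝ), 0 < g x)
    (hg_smooth : ContDiffOn ℝ 1 g (Set.Ici 0))
    (hg_tendsto : Tendsto g atTop atTop)
    (hg_ratio : ∃ C : ℝ, ∀ x > (0:ℝ), |deriv g x / g x| ≤ C) :
    ∀ κ > (0:ℝ),
      Tendsto (fun x : ℝ =>
          g x * (∫ s in (0:ℝ)..x, Real.exp (κ * ∫ u in (0:ℝ)..s, g u)) /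
            Real.exp (κ * ∫ u in (0:ℝ)..x, g u)) atTop (nhds (1/κ)) ∧
      ∃ x₀ > (0:ℝ), ∃ cbar Cbar : ℝ, 0 < cbar ∧ cbar ≤ Cbar ∧
        ∀ x > x₀,
          cbar ≤ g x * (∫ s in (0:ℝ)..x, Real.exp (κ * ∫ u in (0:ℝ)..s, g u)) /
              Real.exp (κ * ∫ u in (0:ℝ)..x, g u) ∧
          g x * (∫ s in (0:ℝ)..x, Real.exp (κ * ∫ u in (0:ℝ)..s, g u)) /
              Real.exp (κ * ∫ u in (0:ℝ)..x, g u) ≤ Cbar := by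
  intro κ hκ
  have hlim := tendsto_mul_integral_exp_div_exp hg_pos hg_smooth hg_tendsto hg_ratio hκ
  refine ⟨hlim, ?_⟩
  have hκ' : 0 < 1 / κ := one_div_pos.2 hκ
  obtain ⟨a, ha⟩ := eventually_atTop.1
    (hlim.eventually (Icc_mem_nhds (half_lt_self hκ') (lt_add_of_pos_right (1 / κ) one_pos)))
  refine ⟨max a 1, lt_max_of_lt_right one_pos, 1 / κ / 2, 1 / κ + 1, half_pos hκ', by linarith,
    fun x hx => ha x ((le_max_left a 1).trans hx.le)⟩
end

section
/- Assume the growth conditions (i) and (ii) on α. Then for every γ ∈ [0,1/2] there is a constant C_γ (depending only on γ and α) such that for all t₁, t₂ > 0, the squared increment σ²(t₁,t₂) := K(t₁,t₁) + K(t₂,t₂) − 2K(t₁,t₂) satisfies σ²(t₁,t₂) ≤ C_γ |t₂ − t₁|^{2γ} [ (α*(t₁ ∨ t₂))^{2γ} (α(t₁ ∧ t₂))^{−1} + (α(t₁ ∨ t₂))^{2γ−1} ]. -/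
open MeasureTheory ProbabilityTheory Real Filter Set

open scoped Topology

lemma hasDerivAt_Aint {a : ℝ → ℝ} (ha : Continuous a) (t : ℝ) : HasDerivAt (Aint a) (a t) t :=
  (ha.integral_hasStrictDerivAt 0 t).hasDerivAt

lemma continuous_Aint {a : ℝ → ℝ} (ha : Continuous a) : Continuous (Aint a) :=
  continuous_iff_continuousAt.2 fun t => (hasDerivAt_Aint ha t).continuousAt

lemma continuous_exp_two_mul_Aint {a : ℝ → ℝ} (ha : Continuous a) :
    Continuous fun u => Real.exp (2 * Aint a u) :=
  Real.continuous_exp.comp (continuous_const.mul (continuous_Aint ha))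

lemma Aint_congr {a b : ℝ → ℝ} (h : ∀ t ≥ 0, a t = b t) {t : ℝ} (ht : 0 ≤ t) :
    Aint a t = Aint b t := by
  refine intervalIntegral.integral_congr fun u hu => ?_
  rw [uIcc_of_le ht] at hu
  exact h u hu.1

lemma Kker_congr {a b : ℝ → ℝ} (h : ∀ t ≥ 0, a t = b t) {s t : ℝ} (hs : 0 ≤ s) (ht : 0 ≤ t) :
    Kker a s t = Kker b s t := by
  unfold Kker
  rw [Aint_congr h hs, Aint_congr h ht]
  congr 1
  refine intervalIntegral.integral_congr fun u hu => ?_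
  rw [uIcc_of_le (le_min hs ht)] at hu
  simp only [Aint_congr h hu.1]

lemma Kker_comm (a : ℝ → ℝ) (s t : ℝ) : Kker a s t = Kker a t s := by
  unfold Kker
  rw [min_comm, show -Aint a s - Aint a t = -Aint a t - Aint a s by ring]

/-- The integral of `exp (2 A)` is at most a constant multiple of `exp (2 A) / a`. -/
lemma exists_integral_exp_le {a : ℝ → ℝ} (ha : Continuous a) (hpos : ∀ t, 0 < a t)
    (hdiff : ∀ t > 0, DifferentiableAt ℝ a t) {c T : ℝ}
    (hderiv : ∀ t > 0, deriv a t ≤ c * a t) (hT : 0 ≤ T) (hlarge : ∀ t ≥ T, c ≤ a t) :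
    ∃ M ≥ (1 : ℝ), ∀ t ≥ 0,
      ∫ u in (0:ℝ)..t, Real.exp (2 * Aint a u) ≤ M * (Real.exp (2 * Aint a t) / a t) := by
  set F : ℝ → ℝ := fun t => ∫ u in (0:ℝ)..t, Real.exp (2 * Aint a u) with hF
  set G : ℝ → ℝ := fun t => Real.exp (2 * Aint a t) / a t with hG
  have hexp := continuous_exp_two_mul_Aint ha
  have hF' : ∀ t, HasDerivAt F (Real.exp (2 * Aint a t)) t := fun t =>
    (hexp.integral_hasStrictDerivAt 0 t).hasDerivAt
  have hFc : Continuous F := continuous_iff_continuousAt.2 fun t => (hF' t).continuousAt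
  have hGc : Continuous G := hexp.div ha fun t => (hpos t).ne'
  have hGpos : ∀ t, 0 < G t := fun t => div_pos (Real.exp_pos _) (hpos t)
  obtain ⟨M₀, hM₀⟩ := (isCompact_Icc (a := (0:ℝ)) (b := T)).bddAbove_image
    (hFc.div hGc fun t => (hGpos t).ne').continuousOn
  have hM : ∀ t ∈ Icc 0 T, F t ≤ max M₀ 1 * G t := fun t ht => by
    rw [← div_le_iff₀ (hGpos t)]
    exact (hM₀ ⟨t, ht, rfl⟩).trans (le_max_left _ _)
  refine ⟨max M₀ 1, le_max_right _ _, fun t ht => ?_⟩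
  rcases le_total t T with htT | hTt
  · exact hM t ⟨ht, htT⟩
  have hmono : MonotoneOn (fun t => max M₀ 1 * G t - F t) (Ici T) := by
    have hd : ∀ x > 0, HasDerivAt (fun t => max M₀ 1 * G t - F t)
        (max M₀ 1 * ((Real.exp (2 * Aint a x) * (2 * a x) * a x -
          Real.exp (2 * Aint a x) * deriv a x) / a x ^ 2) - Real.exp (2 * Aint a x)) x := by
      intro x hx
      exact (((((hasDerivAt_Aint ha x).const_mul 2).exp).div (hdiff x hx).hasDerivAt
        (hpos x).ne').const_mul _).sub (hF' x)
    refine monotoneOn_of_deriv_nonneg (convex_Ici T)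
      ((hGc.const_mul _).sub hFc).continuousOn ?_ ?_
    · intro x hx
      rw [interior_Ici] at hx
      exact (hd x (hT.trans_lt hx)).differentiableAt.differentiableWithinAt
    · intro x hx
      rw [interior_Ici] at hx
      have hx0 : 0 < x := hT.trans_lt hx
      rw [(hd x hx0).deriv]
      have hax := hpos x
      have hE := Real.exp_pos (2 * Aint a x)
      have h1 : deriv a x ≤ a x ^ 2 := by
        nlinarith [hderiv x hx0, hlarge x (le_of_lt hx)]
      have h2 : Real.exp (2 * Aint a x) ≤ (Real.exp (2 * Aint a x) * (2 * a x) * a x -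
          Real.exp (2 * Aint a x) * deriv a x) / a x ^ 2 := by
        rw [le_div_iff₀ (by positivity)]
        nlinarith
      nlinarith [le_max_right M₀ 1]
  have h0 := hM T ⟨hT, le_rfl⟩
  have h1 := hmono self_mem_Ici hTt hTt
  simp only at h1
  change F t ≤ max M₀ 1 * G t
  linarith

lemma Kker_self (a : ℝ → ℝ) (t : ℝ) :
    Kker a t t = (∫ u in (0:ℝ)..t, Real.exp (2 * Aint a u)) / Real.exp (2 * Aint a t) := by
  rw [Kker, min_self, div_eq_mul_inv, ← Real.exp_neg, mul_comm]
  ring_nf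

/-- Variance of the increment split into the contraction of the past and the fresh noise. -/
lemma increment_eq {a : ℝ → ℝ} (ha : Continuous a) {s t : ℝ} (hst : s ≤ t) :
    Kker a s s + Kker a t t - 2 * Kker a s t =
      (1 - Real.exp (-(Aint a t - Aint a s))) ^ 2 * Kker a s s +
        (∫ u in s..t, Real.exp (2 * Aint a u)) / Real.exp (2 * Aint a t) := by
  have hi := (continuous_exp_two_mul_Aint ha).intervalIntegrable (μ := volume)
  rw [Kker_self, Kker_self, Kker, min_eq_left hst,
    ← intervalIntegral.integral_add_adjacent_intervals (hi 0 s) (hi s t)]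
  have h1 : Real.exp (-Aint a s - Aint a t) = (Real.exp (Aint a s) * Real.exp (Aint a t))⁻¹ := by
    rw [← Real.exp_add, ← Real.exp_neg]; ring_nf
  have h2 : Real.exp (-(Aint a t - Aint a s)) = Real.exp (Aint a s) / Real.exp (Aint a t) := by
    rw [← Real.exp_sub]; ring_nf
  have h3 : ∀ x, Real.exp (2 * Aint a x) = Real.exp (Aint a x) ^ 2 := fun x => by
    rw [← Real.exp_nat_mul]; norm_num
  rw [h1, h2, h3 s, h3 t]
  field_simp
  ring

lemma le_alphaStar {α : ℝ → ℝ} (hα : ContinuousOn α (Ici 0)) {r t : ℝ} (hr : r ∈ Icc 0 t) :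
    α r ≤ alphaStar α t :=
  le_csSup (isCompact_Icc.bddAbove_image (hα.mono Icc_subset_Ici_self)) (mem_image_of_mem α hr)

lemma Aint_sub_le {a : ℝ → ℝ} (ha : Continuous a) {s t m : ℝ} (hst : s ≤ t)
    (hm : ∀ u ∈ Icc s t, a u ≤ m) : Aint a t - Aint a s ≤ m * (t - s) := by
  have hi := ha.intervalIntegrable (μ := volume)
  rw [Aint, Aint, intervalIntegral.integral_interval_sub_left (hi 0 t) (hi 0 s)]
  calc ∫ u in s..t, a u ≤ ∫ _ in s..t, m :=
        intervalIntegral.integral_mono_on hst (hi s t) intervalIntegrable_const hm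
    _ = m * (t - s) := by simp [mul_comm]

lemma sq_one_sub_exp_neg_le_rpow {d p : ℝ} (hd : 0 ≤ d) (hp : p ∈ Icc (0:ℝ) 1) :
    (1 - Real.exp (-d)) ^ 2 ≤ d ^ p := by
  have h0 : 0 ≤ 1 - Real.exp (-d) := by
    have := Real.exp_le_one_iff.2 (neg_nonpos.2 hd); linarith
  have h1 : 1 - Real.exp (-d) ≤ 1 := by linarith [Real.exp_pos (-d)]
  have h2 : 1 - Real.exp (-d) ≤ d := by linarith [Real.add_one_le_exp (-d)]
  calc (1 - Real.exp (-d)) ^ 2 ≤ 1 - Real.exp (-d) := by nlinarith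
    _ ≤ (1 - Real.exp (-d)) ^ p := Real.self_le_rpow_of_le_one h0 h1 hp.2
    _ ≤ d ^ p := Real.rpow_le_rpow h0 h2 hp.1

/-- Geometric interpolation between two upper bounds. -/
lemma le_rpow_mul_rpow_of_le {x y z p : ℝ} (hx : 0 < x) (hy : x ≤ y) (hz : x ≤ z)
    (hp : p ∈ Icc (0:ℝ) 1) : x ≤ y ^ p * z ^ (1 - p) :=
  calc x = x ^ p * x ^ (1 - p) := by rw [← Real.rpow_add hx]; simp
    _ ≤ y ^ p * z ^ (1 - p) := mul_le_mul (Real.rpow_le_rpow hx.le hy hp.1)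
        (Real.rpow_le_rpow hx.le hz (by linarith [hp.2])) (by positivity)
        (Real.rpow_nonneg (hx.le.trans hy) _)

/-- The increment bound for ordered times. -/
lemma increment_le {a : ℝ → ℝ} (ha : Continuous a) (hpos : ∀ t, 0 < a t) {M : ℝ} (hM : 1 ≤ M)
    (hint : ∀ t ≥ 0,
      ∫ u in (0:ℝ)..t, Real.exp (2 * Aint a u) ≤ M * (Real.exp (2 * Aint a t) / a t))
    {s t m p : ℝ} (hs : 0 ≤ s) (hst : s < t) (hm : ∀ u ∈ Icc s t, a u ≤ m)
    (hp : p ∈ Icc (0:ℝ) 1) :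
    Kker a s s + Kker a t t - 2 * Kker a s t ≤
      M * (t - s) ^ p * (m ^ p * (a s)⁻¹ + a t ^ (p - 1)) := by
  have hexp := continuous_exp_two_mul_Aint ha
  have hi := hexp.intervalIntegrable (μ := volume)
  have hts : 0 < t - s := sub_pos.2 hst
  have hm0 : 0 ≤ m := (hpos s).le.trans (hm s ⟨le_rfl, hst.le⟩)
  have hV : ∀ x ≥ 0, Kker a x x ≤ M / a x := fun x hx => by
    rw [Kker_self, div_le_iff₀ (Real.exp_pos _)]
    exact (hint x hx).trans_eq (by ring)
  have hA : Monotone (Aint a) := monotone_of_hasDerivAt_nonneg (hasDerivAt_Aint ha)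
    fun x => (hpos x).le
  rw [increment_eq ha hst.le]
  have h1 : (1 - Real.exp (-(Aint a t - Aint a s))) ^ 2 * Kker a s s ≤
      (m ^ p * (t - s) ^ p) * (M / a s) := by
    have h : (1 - Real.exp (-(Aint a t - Aint a s))) ^ 2 ≤ m ^ p * (t - s) ^ p := by
      rw [← Real.mul_rpow hm0 hts.le]
      exact (sq_one_sub_exp_neg_le_rpow (sub_nonneg.2 (hA hst.le)) hp).trans
        (Real.rpow_le_rpow (sub_nonneg.2 (hA hst.le)) (Aint_sub_le ha hst.le hm) hp.1)
    calc _ ≤ (1 - Real.exp (-(Aint a t - Aint a s))) ^ 2 * (M / a s) :=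
          mul_le_mul_of_nonneg_left (hV s hs) (sq_nonneg _)
      _ ≤ _ := mul_le_mul_of_nonneg_right h (div_nonneg (by linarith) (hpos s).le)
  have h2 : (∫ u in s..t, Real.exp (2 * Aint a u)) / Real.exp (2 * Aint a t) ≤
      (t - s) ^ p * (M / a t) ^ (1 - p) := by
    refine le_rpow_mul_rpow_of_le (div_pos (intervalIntegral.intervalIntegral_pos_of_pos
      (hi s t) (fun _ => Real.exp_pos _) hst) (Real.exp_pos _)) ?_ ?_ hp
    · rw [div_le_iff₀ (Real.exp_pos _)]
      calc ∫ u in s..t, Real.exp (2 * Aint a u) ≤ ∫ _ in s..t, Real.exp (2 * Aint a t) :=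
            intervalIntegral.integral_mono_on hst.le (hi s t) intervalIntegrable_const
              fun u hu => Real.exp_le_exp.2 (by linarith [hA hu.2])
        _ = _ := by simp
    · refine le_trans ?_ (hV t (hs.trans hst.le))
      rw [Kker_self, ← intervalIntegral.integral_add_adjacent_intervals (hi 0 s) (hi s t)]
      have := intervalIntegral.integral_nonneg (μ := volume) hs
        fun u _ => (Real.exp_pos (2 * Aint a u)).le
      gcongr
      linarith
  have h3 : (M / a t) ^ (1 - p) ≤ M * a t ^ (p - 1) := by
    rw [Real.div_rpow (by linarith) (hpos t).le, div_eq_mul_inv, ← Real.rpow_neg (hpos t).le,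
      neg_sub]
    exact mul_le_mul_of_nonneg_right
      (Real.rpow_le_self_of_one_le hM (by linarith [hp.1])) (Real.rpow_nonneg (hpos t).le _)
  calc _ ≤ (m ^ p * (t - s) ^ p) * (M / a s) + (t - s) ^ p * (M * a t ^ (p - 1)) :=
        add_le_add h1 (h2.trans (mul_le_mul_of_nonneg_left h3 (Real.rpow_nonneg hts.le _)))
    _ = _ := by ring

/-- Condition (i) forces `α` to eventually exceed any given bound. -/
lemma GrowthCond.exists_le {α : ℝ → ℝ} {γ β : ℝ} (h : GrowthCond α γ β)
    (hpos : ∀ t ≥ 0, 0 < α t) (c : ℝ) : ∃ T ≥ 0, ∀ t ≥ T, c ≤ α t := by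
  obtain ⟨hC1, hγ, hβ, ⟨C, hC, hi⟩, -⟩ := h
  have hm : 0 < α 0 ^ (2 * γ) := Real.rpow_pos_of_pos (hpos 0 le_rfl) _
  obtain ⟨T, hT⟩ := (((tendsto_rpow_atTop hβ).const_mul_atTop
    (div_pos hm hC)).eventually_ge_atTop c).exists_forall_of_atTop
  refine ⟨max T 1, by positivity, fun t ht => (hT t ((le_max_left _ _).trans ht)).trans ?_⟩
  have ht0 : 0 < t := one_pos.trans_le ((le_max_right _ _).trans ht)
  have h1 : α 0 ^ (2 * γ) / α t ≤ C * t ^ (-β) := by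
    refine le_trans ?_ (hi t ht0)
    have := hpos t ht0.le
    gcongr
    · exact (hpos 0 le_rfl).le
    · linarith [hγ.1]
    · exact le_alphaStar hC1.continuousOn ⟨le_rfl, by linarith⟩
  rw [Real.rpow_neg ht0.le, ← div_eq_mul_inv,
    div_le_div_iff₀ (hpos t ht0.le) (Real.rpow_pos_of_pos ht0 _)] at h1
  rw [div_mul_eq_mul_div, div_le_iff₀ hC]
  linarith

theorem stmt_1 (α : ℝ → ℝ)
    (hα_pos : ∀ t ≥ (0:ℝ), 0 < α t)
    (hα_cont : ContinuousOn α (Set.Ici 0))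
    (hgrowth : ∃ γ₀ β : ℝ, GrowthCond α γ₀ β) :
    ∀ γ ∈ Set.Icc (0:ℝ) (1/2), ∃ C > (0:ℝ), ∀ t₁ > (0:ℝ), ∀ t₂ > (0:ℝ),
      Kker α t₁ t₁ + Kker α t₂ t₂ - 2 * Kker α t₁ t₂ ≤
        C * |t₂ - t₁| ^ (2*γ) *
          ((alphaStar α (max t₁ t₂)) ^ (2*γ) * (α (min t₁ t₂))⁻¹ +
            (α (max t₁ t₂)) ^ (2*γ - 1)) := by
  intro γ hγ
  obtain ⟨γ₀, β, hg⟩ := hgrowth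
  obtain ⟨c, hc⟩ := hg.2.2.2.2
  obtain ⟨T, hT, hlarge⟩ := hg.exists_le hα_pos c
  set a : ℝ → ℝ := fun t => α (max t 0) with ha_def
  have hαa : ∀ t ≥ 0, α t = a t := fun t ht => by simp only [ha_def, max_eq_left ht]
  have ha : Continuous a := hα_cont.comp_continuous (by fun_prop) fun t => le_max_right t 0
  have hpos : ∀ t, 0 < a t := fun t => hα_pos _ (le_max_right t 0)
  have hev : ∀ t > 0, a =ᶠ[𝓝 t] α := fun t ht => by
    filter_upwards [lt_mem_nhds ht] with u hu using (hαa u hu.le).symm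
  obtain ⟨M, hM, hint⟩ := exists_integral_exp_le (c := c) (T := T) ha hpos
    (fun t ht => ((hg.1.differentiableOn one_ne_zero t ht.le).differentiableAt
      (Ici_mem_nhds ht)).congr_of_eventuallyEq (hev t ht))
    (fun t ht => by
      rw [(hev t ht).deriv_eq, ← hαa t ht.le, ← div_le_iff₀ (hα_pos t ht.le)]
      exact (le_abs_self _).trans (hc t ht.le))
    hT (fun t ht => by rw [← hαa t (hT.trans ht)]; exact hlarge t ht)
  have key : ∀ s > 0, ∀ t, s ≤ t → Kker α s s + Kker α t t - 2 * Kker α s t ≤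
      M * (t - s) ^ (2*γ) * (alphaStar α t ^ (2*γ) * (α s)⁻¹ + α t ^ (2*γ - 1)) := by
    intro s hs t hst
    have ht := hs.le.trans hst
    rcases hst.eq_or_lt with rfl | hlt
    · have h1 := hα_pos s hs.le
      have h2 := h1.le.trans (le_alphaStar hα_cont ⟨ht, le_rfl⟩)
      rw [show Kker α s s + Kker α s s - 2 * Kker α s s = 0 by ring, sub_self]
      positivity
    · rw [Kker_congr hαa hs.le hs.le, Kker_congr hαa ht ht, Kker_congr hαa hs.le ht,
        hαa s hs.le, hαa t ht]
      refine increment_le ha hpos hM hint hs.le hlt (fun u hu => ?_)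
        ⟨by linarith [hγ.1], by linarith [hγ.2]⟩
      have hu0 := hs.le.trans hu.1
      rw [← hαa u hu0]
      exact le_alphaStar hα_cont ⟨hu0, hu.2⟩
  refine ⟨M, by linarith, fun t₁ h₁ t₂ h₂ => ?_⟩
  rcases le_total t₁ t₂ with h | h
  · rw [max_eq_right h, min_eq_left h, abs_of_nonneg (sub_nonneg.2 h)]
    exact key t₁ h₁ t₂ h
  · rw [max_eq_left h, min_eq_right h, abs_sub_comm, abs_of_nonneg (sub_nonneg.2 h),
      Kker_comm α t₁ t₂, add_comm (Kker α t₁ t₁)]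
    exact key t₂ h₂ t₁ h
end

section
/- Let (X_t)_{t≥0} be an infinite time horizon Brownian bridge whose coefficient α satisfies the growth conditions (i) and (ii). Then X_n → 0 almost surely as n → ∞ along the positive integers. -/
open MeasureTheory ProbabilityTheory Real Filter Set

/-- Replacing `α` by its continuous extension `u ↦ α (max u 0)` does not change the variance. -/
lemma Kker_self_congr_max (α : ℝ → ℝ) {t : ℝ} (ht : 0 ≤ t) :
    Kker (fun u => α (max u 0)) t t = Kker α t t := by
  have hA : ∀ s, 0 ≤ s → Aint (fun u => α (max u 0)) s = Aint α s := by
    intro s hs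
    refine intervalIntegral.integral_congr fun u hu => ?_
    rw [uIcc_of_le hs] at hu
    simp [max_eq_left hu.1]
  unfold Kker
  rw [hA t ht, min_self]
  congr 1
  refine intervalIntegral.integral_congr fun u hu => ?_
  rw [uIcc_of_le ht] at hu
  simp [hA u hu.1]

/-- Under a power lower bound on `α`, the variance decays polynomially. -/
lemma exists_Kker_self_le {α : ℝ → ℝ} (hα : Continuous α) {β c : ℝ} (hβ : 0 < β) (hc : 0 < c)
    (hlow : ∀ t > (0 : ℝ), c * t ^ β ≤ α t) :
    ∃ M > (0 : ℝ), ∃ T > (0 : ℝ), ∀ t ≥ T, Kker α t t ≤ M * t ^ (-β) := by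
  have hA : ∀ t, HasDerivAt (Aint α) (α t) t := fun t =>
    (hα.integral_hasStrictDerivAt 0 t).hasDerivAt
  have hAc : Continuous (Aint α) := continuous_iff_continuousAt.2 fun t => (hA t).continuousAt
  have hEc : Continuous fun u => Real.exp (2 * Aint α u) := by fun_prop
  set F : ℝ → ℝ := fun t => ∫ u in (0 : ℝ)..t, Real.exp (2 * Aint α u) with hFdef
  have hF : ∀ t, HasDerivAt F (Real.exp (2 * Aint α t)) t := fun t =>
    (hEc.integral_hasStrictDerivAt 0 t).hasDerivAt
  obtain ⟨T, hT1, hTc⟩ : ∃ T : ℝ, 1 ≤ T ∧ β ≤ c * T :=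
    ⟨max 1 (β / c), le_max_left _ _, by
      have := le_max_right 1 (β / c)
      rwa [div_le_iff₀' hc] at this⟩
  have hT0 : 0 < T := by linarith
  set M : ℝ := max (1 / c) (F T * Real.exp (-(2 * Aint α T)) * T ^ β) with hM
  have hMc : 1 ≤ c * M := by
    have := le_max_left (1 / c) (F T * Real.exp (-(2 * Aint α T)) * T ^ β)
    rwa [← hM, div_le_iff₀' hc] at this
  have hM0 : 0 < M := lt_of_lt_of_le (by positivity) (le_max_left _ _)
  set G : ℝ → ℝ := fun t => M * (Real.exp (2 * Aint α t) * t ^ (-β)) - F t with hG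
  have hGd : ∀ t, 0 < t → HasDerivAt G (M * (Real.exp (2 * Aint α t) * (2 * α t) * t ^ (-β) +
      Real.exp (2 * Aint α t) * (-β * t ^ (-β - 1))) - Real.exp (2 * Aint α t)) t := by
    intro t ht
    exact ((((hA t).const_mul 2).exp.mul
      (Real.hasDerivAt_rpow_const (Or.inl ht.ne'))).const_mul M).sub (hF t)
  have hmono : MonotoneOn G (Ici T) := by
    refine monotoneOn_of_deriv_nonneg (convex_Ici T)
      (fun t ht => (hGd t (hT0.trans_le ht)).continuousAt.continuousWithinAt)
      (fun t ht => ?_) fun t ht => ?_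
    · rw [interior_Ici] at ht
      exact (hGd t (hT0.trans ht)).differentiableAt.differentiableWithinAt
    · rw [interior_Ici] at ht
      have htT : T < t := ht
      have ht0 : 0 < t := hT0.trans ht
      rw [(hGd t ht0).deriv]
      have hp : c ≤ α t * t ^ (-β) := by
        have := mul_le_mul_of_nonneg_right (hlow t ht0) (Real.rpow_nonneg ht0.le (-β))
        rwa [mul_assoc, ← Real.rpow_add ht0, add_neg_cancel, Real.rpow_zero, mul_one] at this
      have hq : β * t ^ (-β - 1) ≤ c := by
        rw [Real.rpow_sub_one ht0.ne']
        have h1 : t ^ (-β) ≤ 1 := Real.rpow_le_one_of_one_le_of_nonpos (by linarith) (by linarith)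
        rw [mul_div_assoc', div_le_iff₀ ht0]
        nlinarith
      have key : 0 ≤ M * (2 * (α t * t ^ (-β)) - β * t ^ (-β - 1)) - 1 := by nlinarith
      have := mul_nonneg (Real.exp_pos (2 * Aint α t)).le key
      linarith
  have hGT : 0 ≤ G T := by
    have h := le_max_right (1 / c) (F T * Real.exp (-(2 * Aint α T)) * T ^ β)
    rw [← hM] at h
    have h2 := mul_le_mul_of_nonneg_right h
      (mul_pos (Real.exp_pos (2 * Aint α T)) (Real.rpow_pos_of_pos hT0 (-β))).le
    have h3 : F T * Real.exp (-(2 * Aint α T)) * T ^ β *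
        (Real.exp (2 * Aint α T) * T ^ (-β)) = F T := by
      rw [Real.exp_neg, Real.rpow_neg hT0.le]
      have := Real.rpow_pos_of_pos hT0 β
      field_simp
    rw [h3] at h2
    exact sub_nonneg.2 h2
  refine ⟨M, hM0, T, hT0, fun t ht => ?_⟩
  have hGt : F t ≤ M * (Real.exp (2 * Aint α t) * t ^ (-β)) :=
    sub_nonneg.1 (hGT.trans (hmono self_mem_Ici ht ht))
  have h4 := mul_le_mul_of_nonneg_left hGt (Real.exp_pos (-(Aint α t) - Aint α t)).le
  have h5 : Real.exp (-(Aint α t) - Aint α t) * (M * (Real.exp (2 * Aint α t) * t ^ (-β))) =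
      M * t ^ (-β) := by
    have : Real.exp (-(Aint α t) - Aint α t) * Real.exp (2 * Aint α t) = 1 := by
      rw [← Real.exp_add, ← Real.exp_zero]
      congr 1
      ring
    linear_combination (M * t ^ (-β)) * this
  rw [h5] at h4
  simpa [Kker, hFdef] using h4

/-- The growth condition forces a power lower bound on `α`. -/
lemma GrowthCond.exists_rpow_le {α : ℝ → ℝ} {γ β : ℝ} (h : GrowthCond α γ β)
    (hpos : ∀ t ≥ (0 : ℝ), 0 < α t) : ∃ c > (0 : ℝ), ∀ t > (0 : ℝ), c * t ^ β ≤ α t := by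
  obtain ⟨hd, hγ, -, ⟨C, hC, hb⟩, -⟩ := h
  have h0 : 0 < α 0 := hpos 0 le_rfl
  refine ⟨α 0 ^ (2 * γ) / C, by positivity, fun t ht => ?_⟩
  have hstar : α 0 ≤ alphaStar α (t + 1) :=
    le_csSup (isCompact_Icc.image_of_continuousOn
      (hd.continuousOn.mono Icc_subset_Ici_self)).bddAbove ⟨0, ⟨le_rfl, by linarith⟩, rfl⟩
  have h1 : α 0 ^ (2 * γ) ≤ alphaStar α (t + 1) ^ (2 * γ) :=
    Real.rpow_le_rpow h0.le hstar (by linarith [hγ.1])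
  have h2 := hb t ht
  have htβ := Real.rpow_pos_of_pos ht β
  rw [div_le_iff₀ (hpos t ht.le), Real.rpow_neg ht.le] at h2
  have h3 := h1.trans h2
  rw [div_mul_eq_mul_div, div_le_iff₀ hC]
  calc α 0 ^ (2 * γ) * t ^ β ≤ C * (t ^ β)⁻¹ * α t * t ^ β := by gcongr
    _ = α t * C := by field_simp

/-- One-dimensional marginals of a bridge are centered Gaussian with variance `Kker α t t`. -/
lemma IsBridge.map_eq_gaussianReal {Ω : Type*} [MeasurableSpace Ω] {P : Measure Ω} {α : ℝ → ℝ}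
    {X : ℝ → Ω → ℝ} (hX : IsBridge P α X) {t : ℝ} (ht : 0 ≤ t) :
    AEMeasurable (X t) P ∧
      ∃ v : NNReal, (v : ℝ) = Kker α t t ∧ P.map (X t) = gaussianReal 0 v := by
  obtain ⟨v, hv⟩ := hX.1 1 (fun _ => 1) (fun _ => t) fun _ => ht
  simp only [Finset.univ_unique, one_mul, Finset.sum_const, Finset.card_singleton, one_smul] at hv
  have hne : NeZero (P.map (X t)) := ⟨by rw [hv]; exact IsProbabilityMeasure.ne_zero _⟩
  have hm : AEMeasurable (X t) P := aemeasurable_of_map_neZero hne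
  refine ⟨hm, v, ?_, hv⟩
  have h1 : ∫ x, x ^ 2 ∂(P.map (X t)) = ∫ ω, X t ω ^ 2 ∂P :=
    integral_map hm (by fun_prop)
  have h2 : ∫ x, x ^ 2 ∂(gaussianReal 0 v) = v := by
    have := variance_fun_id_gaussianReal (μ := 0) (v := v)
    rwa [variance_of_integral_eq_zero (by fun_prop) (by simp)] at this
  rw [← hX.2 t t ht ht, ← h2, ← hv, h1]
  simp only [sq]

/-- Tail bound for a centered Gaussian variable with variance at most `σ`. -/
lemma measure_le_abs_le_of_map_eq_gaussianReal {Ω : Type*} [MeasurableSpace Ω] {P : Measure Ω}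
    [IsProbabilityMeasure P] {Y : Ω → ℝ} {v σ : NNReal} (hm : AEMeasurable Y P)
    (hY : P.map Y = gaussianReal 0 v) (hv : v ≤ σ) {ε : ℝ} (hε : 0 ≤ ε) :
    P {ω | ε ≤ |Y ω|} ≤ ENNReal.ofReal (2 * Real.exp (-ε ^ 2 / (2 * σ))) := by
  have hsub : HasSubgaussianMGF Y σ P := by
    refine ⟨fun t => ?_, fun t => ?_⟩
    · have := integrable_exp_mul_gaussianReal (μ := 0) (v := v) t
      rw [← hY] at this
      exact (integrable_map_measure (by fun_prop) hm).1 this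
    · rw [mgf_gaussianReal hY]
      have : (v : ℝ) ≤ σ := hv
      gcongr
      simpa using by gcongr
  have h1 := hsub.measure_ge_le hε
  have h2 := hsub.neg.measure_ge_le hε
  have h3 : {ω | ε ≤ |Y ω|} ⊆ {ω | ε ≤ Y ω} ∪ {ω | ε ≤ (-Y) ω} := fun ω (hω : ε ≤ |Y ω|) =>
    le_abs.1 hω
  have h4 := (measureReal_mono h3).trans (measureReal_union_le (μ := P) _ _)
  rw [← ofReal_measureReal]
  exact ENNReal.ofReal_le_ofReal (by linarith)

lemma summable_exp_neg_mul_rpow_nat {a β : ℝ} (ha : 0 < a) (hβ : 0 < β) :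
    Summable fun n : ℕ => Real.exp (-a * (n : ℝ) ^ β) := by
  have h := (isLittleO_exp_neg_mul_rpow_atTop ha (-2 / β)).comp_tendsto
    ((tendsto_rpow_atTop hβ).comp tendsto_natCast_atTop_atTop)
  refine summable_of_isBigO_nat (Real.summable_nat_rpow.2 (by norm_num : (-2 : ℝ) < -1))
    (h.isBigO.congr_right fun n => ?_)
  simp only [Function.comp]
  rw [← Real.rpow_mul n.cast_nonneg]
  congr 1
  field_simp

theorem stmt_3 {Ω : Type*} [MeasurableSpace Ω] (P : Measure Ω) [IsProbabilityMeasure P]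
    (α : ℝ → ℝ) (X : ℝ → Ω → ℝ)
    (hα_pos : ∀ t ≥ (0:ℝ), 0 < α t)
    (hα_cont : ContinuousOn α (Set.Ici 0))
    (hgrowth : ∃ γ β : ℝ, GrowthCond α γ β)
    (hX : IsBridge P α X) :
    ∀ᵐ ω ∂P, Tendsto (fun n : ℕ => X n ω) atTop (nhds 0) := by
  obtain ⟨γ, β, hg⟩ := hgrowth
  have hβ : 0 < β := hg.2.2.1
  obtain ⟨c, hc, hlow⟩ := hg.exists_rpow_le hα_pos
  have hcont : Continuous fun u => α (max u 0) :=
    hα_cont.comp_continuous (by fun_prop) fun u => mem_Ici.2 (le_max_right u 0)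
  obtain ⟨M, hM, T, -, hK⟩ := exists_Kker_self_le hcont hβ hc fun t ht => by
    simpa [max_eq_left ht.le] using hlow t ht
  have hev : ∀ k : ℕ, ∀ᵐ ω ∂P, ∀ᶠ n : ℕ in atTop, |X n ω| < 1 / ((k : ℝ) + 1) := by
    intro k
    set ε : ℝ := 1 / ((k : ℝ) + 1) with hεdef
    have hε : 0 < ε := by positivity
    obtain ⟨N, hN⟩ := exists_nat_ge (max T 1)
    have hsum : Summable fun n : ℕ => 2 * Real.exp (-(ε ^ 2 / (2 * M)) * (n : ℝ) ^ β) :=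
      (summable_exp_neg_mul_rpow_nat (by positivity) hβ).mul_left 2
    have hbound : ∀ n : ℕ, P {ω | ε ≤ |X ((n + N : ℕ) : ℝ) ω|} ≤
        ENNReal.ofReal (2 * Real.exp (-(ε ^ 2 / (2 * M)) * ((n + N : ℕ) : ℝ) ^ β)) := by
      intro n
      have hn : max T 1 ≤ ((n + N : ℕ) : ℝ) := hN.trans (by exact_mod_cast Nat.le_add_left N n)
      generalize ((n + N : ℕ) : ℝ) = t at hn ⊢
      have ht : 0 < t := by linarith [le_max_right T 1]
      obtain ⟨hm, v, hv, hmap⟩ := hX.map_eq_gaussianReal ht.le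
      have hvb : (v : ℝ) ≤ M * t ^ (-β) := by
        rw [hv, ← Kker_self_congr_max α ht.le]
        exact hK t ((le_max_left T 1).trans hn)
      refine (measure_le_abs_le_of_map_eq_gaussianReal (σ := NNReal.mk (M * t ^ (-β)) (by positivity))
        hm hmap hvb hε.le).trans_eq ?_
      congr 3
      rw [NNReal.coe_mk, Real.rpow_neg ht.le]
      have := Real.rpow_pos_of_pos ht β
      field_simp
    have hfin : ∑' n : ℕ, P {ω | ε ≤ |X ((n + N : ℕ) : ℝ) ω|} ≠ ⊤ :=
      ne_top_of_le_ne_top ((summable_nat_add_iff N).2 hsum).tsum_ofReal_ne_top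
        (ENNReal.tsum_le_tsum hbound)
    filter_upwards [ae_eventually_notMem hfin] with ω hω
    rw [← map_add_atTop_eq_nat N, eventually_map]
    filter_upwards [hω] with n hn
    simpa using hn
  filter_upwards [ae_all_iff.2 hev] with ω hω
  rw [Metric.tendsto_nhds]
  intro ε hε
  obtain ⟨k, hk⟩ := exists_nat_one_div_lt hε
  filter_upwards [hω k] with n hn
  rw [Real.dist_eq, sub_zero]
  exact hn.trans hk
end

section
/- Let (X_t)_{t≥0} be an infinite time horizon Brownian bridge with almost surely continuous sample paths whose coefficient α satisfies the growth conditions (i) and (ii). Then X_t → 0 almost surely as t → ∞; in particular, setting X_∞ = 0, the extended process (X_t)_{0≤t≤∞} has almost surely continuous sample paths on the closed infinite time horizon [0,∞]. -/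
open MeasureTheory ProbabilityTheory Real Filter Set

/-- A Hájek–Rényi type maximal inequality. -/
theorem hajekRenyi_maximal_ineq {Ω : Type*} [MeasurableSpace Ω] {P : Measure Ω}
    [IsProbabilityMeasure P] {Y : ℕ → Ω → ℝ} {c : ℕ → ℝ} {ε : ℝ}
    (hm : ∀ n, Measurable (Y n)) (hint : ∀ n, Integrable (Y n) P) (hY : ∀ n ω, 0 ≤ Y n ω)
    (hc : Antitone c) (hc0 : ∀ n, 0 ≤ c n)
    (hsub : ∀ n, ∫ ω in {ω | ∀ i ≤ n, c i * Y i ω < ε}ᶜ, Y n ω ∂P ≤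
      ∫ ω in {ω | ∀ i ≤ n, c i * Y i ω < ε}ᶜ, Y (n + 1) ω ∂P) (n : ℕ) :
    ε * P.real {ω | ∀ i ≤ n, c i * Y i ω < ε}ᶜ ≤ c 0 * ∫ ω, Y 0 ω ∂P +
      ∑ k ∈ Finset.range n, c (k + 1) * (∫ ω, Y (k + 1) ω ∂P - ∫ ω, Y k ω ∂P) := by
  set B : ℕ → Set Ω := fun n => {ω | ∀ i ≤ n, c i * Y i ω < ε} with hB
  have hBm : ∀ n, MeasurableSet (B n) := fun n => by
    have : B n = ⋂ i, ⋂ (_ : i ≤ n), {ω | c i * Y i ω < ε} := by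
      ext; simp [hB]
    rw [this]
    exact MeasurableSet.iInter fun i => MeasurableSet.iInter fun _ =>
      measurableSet_lt ((hm i).const_mul _) measurable_const
  have hBanti : ∀ n, B (n + 1) ⊆ B n := fun n ω h i hi => h i (by lia)
  suffices H : ε * P.real (B n)ᶜ + c n * ∫ ω in B n, Y n ω ∂P ≤ c 0 * ∫ ω, Y 0 ω ∂P +
      ∑ k ∈ Finset.range n, c (k + 1) * (∫ ω, Y (k + 1) ω ∂P - ∫ ω, Y k ω ∂P) by
    have : 0 ≤ c n * ∫ ω in B n, Y n ω ∂P := mul_nonneg (hc0 n) (integral_nonneg (hY n))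
    linarith
  induction n with
  | zero =>
    have h1 : ε * P.real (B 0)ᶜ ≤ ∫ ω in (B 0)ᶜ, c 0 * Y 0 ω ∂P :=
      setIntegral_ge_of_const_le_real (hBm 0).compl (measure_ne_top _ _)
        (fun ω hω => by simpa [hB] using hω) ((hint 0).const_mul _).integrableOn
    rw [integral_const_mul] at h1
    have h2 := integral_add_compl (hBm 0) (hint 0)
    simp only [Finset.range_zero, Finset.sum_empty, add_zero]
    rw [← h2]
    linarith
  | succ n ih =>
    have h1 : ε * P.real (B n \ B (n + 1)) ≤ ∫ ω in B n \ B (n + 1), c (n + 1) * Y (n + 1) ω ∂P := by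
      refine setIntegral_ge_of_const_le_real ((hBm n).diff (hBm (n + 1))) (measure_ne_top _ _)
        (fun ω hω => ?_) ((hint _).const_mul _).integrableOn
      by_contra! hlt
      refine hω.2 fun i hi => ?_
      rcases Nat.le_succ_iff.1 hi with h | rfl
      · exact hω.1 i h
      · exact hlt
    rw [integral_const_mul] at h1
    have h2 : ∫ ω in B n \ B (n + 1), Y (n + 1) ω ∂P =
        ∫ ω in B n, Y (n + 1) ω ∂P - ∫ ω in B (n + 1), Y (n + 1) ω ∂P :=
      setIntegral_sdiff (hBm (n + 1)) (hint _).integrableOn (hBanti n)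
    have h3 : P.real (B (n + 1))ᶜ = P.real (B n)ᶜ + P.real (B n \ B (n + 1)) := by
      rw [measureReal_compl (hBm _), measureReal_compl (hBm _),
        measureReal_sdiff (hBanti n) (hBm _)]
      ring
    have h4 := integral_add_compl (hBm n) (hint n)
    have h5 := integral_add_compl (hBm n) (hint (n + 1))
    have h6 := hsub n
    have h7 : c (n + 1) * ∫ ω in B n, Y n ω ∂P ≤ c n * ∫ ω in B n, Y n ω ∂P :=
      mul_le_mul_of_nonneg_right (hc (Nat.le_succ n)) (integral_nonneg (hY n))
    have h8 := mul_le_mul_of_nonneg_left h6 (hc0 (n + 1))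
    rw [Finset.sum_range_succ, h3, ← h5, ← h4]
    rw [h2] at h1
    change _ * ∫ ω in (B n)ᶜ, Y n ω ∂P ≤ _ * ∫ ω in (B n)ᶜ, Y (n + 1) ω ∂P at h8
    linarith

theorem pow_add_tangent_le (q : ℕ) (x y : ℝ) :
    x ^ (2 * (q + 1)) + (2 * (q + 1)) * x ^ (2 * q + 1) * (y - x) ≤ y ^ (2 * (q + 1)) := by
  have hconv : ConvexOn ℝ univ fun x : ℝ => x ^ (2 * (q + 1)) := (even_two_mul _).convexOn_pow
  have hd : HasDerivAt (fun x : ℝ => x ^ (2 * (q + 1))) ((2 * (q + 1)) * x ^ (2 * q + 1)) x := by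
    simpa using! hasDerivAt_pow (2 * (q + 1)) x
  rcases lt_trichotomy x y with h | rfl | h
  · have := hconv.le_slope_of_hasDerivAt (mem_univ _) (mem_univ _) h hd
    rw [slope_def_field, le_div_iff₀ (by linarith)] at this
    linarith
  · simp
  · have := hconv.slope_le_of_hasDerivAt (mem_univ _) (mem_univ _) h hd
    rw [slope_def_field, div_le_iff₀ (by linarith)] at this
    linarith

theorem IsGaussianProcess.indepFun_increment {Ω : Type*} [MeasurableSpace Ω] {P : Measure Ω}
    {M : ℕ → Ω → ℝ} (hM : IsGaussianProcess M P) (n : ℕ)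
    (horth : ∀ i ≤ n, cov[M i, fun ω => M (n + 1) ω - M n ω; P] = 0) :
    IndepFun (fun ω (i : Finset.Iic n) => M i ω) (fun ω (_ : Unit) => M (n + 1) ω - M n ω) P := by
  refine HasGaussianLaw.indepFun_of_covariance_eval
    (X := fun i : Finset.Iic n => M i) (Y := fun (_ : Unit) ω => M (n + 1) ω - M n ω) ?_
    fun i _ => horth i (Finset.mem_Iic.1 i.2)
  let L : (Finset.Iic (n + 1) → ℝ) →L[ℝ] (Finset.Iic n → ℝ) × (Unit → ℝ) :=
    { toFun x := (fun i => x ⟨i, Finset.mem_Iic.2 ((Finset.mem_Iic.1 i.2).trans n.le_succ)⟩,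
        fun _ => x ⟨n + 1, by simp⟩ - x ⟨n, by simp⟩)
      map_add' x y := by ext <;> simp; ring
      map_smul' a x := by ext <;> simp; ring }
  exact (hM.hasGaussianLaw (Finset.Iic (n + 1))).map L

theorem gaussianReal_integral_even_pow (v : NNReal) (p : ℕ) :
    ∫ x, x ^ (2 * p) ∂(gaussianReal 0 v) = (∫ x, x ^ (2 * p) ∂(gaussianReal 0 1)) * v ^ p := by
  have h : gaussianReal 0 v = (gaussianReal 0 1).map (√v * ·) := by
    rw [gaussianReal_map_const_mul]
    congr 1
    · simp
    · ext; simp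
  have hv : √(v : ℝ) ^ 2 = v := Real.sq_sqrt v.2
  rw [h, integral_map (by fun_prop) (by fun_prop), ← integral_mul_const]
  congr 1 with x
  rw [mul_pow, pow_mul √(v : ℝ), hv]
  ring

theorem HasGaussianLaw.integral_even_pow {Ω : Type*} [MeasurableSpace Ω] {P : Measure Ω}
    {Z : Ω → ℝ} (hZ : HasGaussianLaw Z P) (h0 : ∫ ω, Z ω ∂P = 0) (p : ℕ) :
    ∫ ω, Z ω ^ (2 * p) ∂P =
      (∫ x, x ^ (2 * p) ∂(gaussianReal 0 1)) * (∫ ω, Z ω * Z ω ∂P) ^ p := by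
  have h1 : ∫ ω, Z ω ^ (2 * p) ∂P = ∫ x, x ^ (2 * p) ∂(P.map Z) := by
    rw [integral_map hZ.aemeasurable (by fun_prop)]
  have h2 : Var[Z; P] = ∫ ω, Z ω * Z ω ∂P := by
    rw [variance_of_integral_eq_zero hZ.aemeasurable h0]
    simp [pow_two]
  rw [h1, hZ.map_eq_gaussianReal, h0, gaussianReal_integral_even_pow,
    Real.coe_toNNReal _ (variance_nonneg _ _), h2]

theorem HasGaussianLaw.integrable_pow {Ω : Type*} [MeasurableSpace Ω] {P : Measure Ω}
    {Z : Ω → ℝ} (hZ : HasGaussianLaw Z P) (p : ℕ) : Integrable (fun ω => Z ω ^ p) P := by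
  have := hZ.isProbabilityMeasure
  rcases Nat.eq_zero_or_pos p with rfl | hp
  · simp
  · have := (hZ.memLp (p := (p : ENNReal)) (by simp)).integrable_norm_pow (by lia)
    refine (integrable_norm_iff (hZ.aemeasurable.pow_const p).aestronglyMeasurable).1 ?_
    simpa using this

theorem IsGaussianProcess.setIntegral_even_pow_le {Ω : Type*} [MeasurableSpace Ω] {P : Measure Ω}
    {M : ℕ → Ω → ℝ} (hM : IsGaussianProcess M P) (h0 : ∀ i, ∫ ω, M i ω ∂P = 0) (n q : ℕ)
    (horth : ∀ i ≤ n, ∫ ω, M i ω * (M (n + 1) ω - M n ω) ∂P = 0)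
    {S : Set (Finset.Iic n → ℝ)} (hS : MeasurableSet S)
    (hSP : MeasurableSet {ω | (fun i : Finset.Iic n => M i ω) ∈ S}) :
    ∫ ω in {ω | (fun i : Finset.Iic n => M i ω) ∈ S}, M n ω ^ (2 * (q + 1)) ∂P ≤
      ∫ ω in {ω | (fun i : Finset.Iic n => M i ω) ∈ S}, M (n + 1) ω ^ (2 * (q + 1)) ∂P := by
  have := hM.isProbabilityMeasure
  let f : (Finset.Iic n → ℝ) → ℝ := S.indicator fun x => x ⟨n, by simp⟩ ^ (2 * q + 1)
  have hf : Measurable f := Measurable.indicator (by fun_prop) hS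
  let g : (Unit → ℝ) → ℝ := fun y => y ()
  have hI := fun i p => HasGaussianLaw.integrable_pow (hM.hasGaussianLaw_eval i) p
  have hdiff : ∫ ω, (M (n + 1) ω - M n ω) ∂P = 0 := by
    rw [integral_sub (hM.hasGaussianLaw_eval _).integrable (hM.hasGaussianLaw_eval _).integrable,
      h0, h0, sub_zero]
  have hind := IsGaussianProcess.indepFun_increment hM n fun i hi => by
    simpa [covariance, hdiff, h0 i] using horth i hi
  have hmul := hind.integral_fun_comp_mul_comp (f := f) (g := g)
    (aemeasurable_pi_lambda _ fun i => hM.aemeasurable _)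
    (aemeasurable_pi_lambda _ fun i => (hM.aemeasurable _).sub (hM.aemeasurable _))
    hf.aestronglyMeasurable (by fun_prop)
  have hcross : ∫ ω in {ω | (fun i : Finset.Iic n => M i ω) ∈ S},
      M n ω ^ (2 * q + 1) * (M (n + 1) ω - M n ω) ∂P = 0 := by
    rw [← integral_indicator hSP]
    simp only [g, hdiff, mul_zero] at hmul
    rw [← hmul]
    congr 1 with ω
    by_cases h : (fun i : Finset.Iic n => M i ω) ∈ S
    · rw [indicator_of_mem (s := {ω | (fun i : Finset.Iic n => M i ω) ∈ S}) h]
      simp only [f, indicator_of_mem h]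
    · rw [indicator_of_notMem (s := {ω | (fun i : Finset.Iic n => M i ω) ∈ S}) h]
      simp only [f, indicator_of_notMem h, zero_mul]
  have hprod : Integrable (fun ω => M n ω ^ (2 * q + 1) * (M (n + 1) ω - M n ω)) P := by
    have hL : ∀ j, MemLp (fun ω => M n ω ^ (2 * q + 1) * M j ω) 1 P := fun j => by
      have h1 : MemLp (fun ω => M n ω ^ (2 * q + 1)) 2 P := by
        rw [memLp_two_iff_integrable_sq ((hM.aemeasurable n).pow_const _).aestronglyMeasurable]
        simpa only [← pow_mul] using hI n ((2 * q + 1) * 2)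
      exact (hM.hasGaussianLaw_eval j).memLp_two.mul h1
    simp_rw [mul_sub]
    exact (memLp_one_iff_integrable.1 (hL _)).sub (memLp_one_iff_integrable.1 (hL _))
  calc ∫ ω in {ω | (fun i : Finset.Iic n => M i ω) ∈ S}, M n ω ^ (2 * (q + 1)) ∂P
      = ∫ ω in {ω | (fun i : Finset.Iic n => M i ω) ∈ S}, (M n ω ^ (2 * (q + 1)) +
          (2 * (q + 1)) * (M n ω ^ (2 * q + 1) * (M (n + 1) ω - M n ω))) ∂P := by
        rw [integral_add (hI _ _).integrableOn (hprod.const_mul _).integrableOn,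
          integral_const_mul, hcross, mul_zero, add_zero]
    _ ≤ _ := by
        refine integral_mono (((hI _ _).add (hprod.const_mul _)).integrableOn)
          (hI _ _).integrableOn fun ω => ?_
        have := pow_add_tangent_le q (M n ω) (M (n + 1) ω)
        simp only
        linarith

theorem IsGaussianProcess.maximal_ineq {Ω : Type*} [MeasurableSpace Ω] {P : Measure Ω}
    {M : ℕ → Ω → ℝ} (hM : IsGaussianProcess M P) (h0 : ∀ i, ∫ ω, M i ω ∂P = 0)
    (horth : ∀ n, ∀ i ≤ n, ∫ ω, M i ω * (M (n + 1) ω - M n ω) ∂P = 0)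
    {c : ℕ → ℝ} (hc : Antitone c) (hc0 : ∀ n, 0 ≤ c n) (q : ℕ) (ε : ℝ) (n : ℕ) :
    ε * P.real {ω | ∃ i ≤ n, ε ≤ c i * M i ω ^ (2 * (q + 1))} ≤
      c 0 * ∫ ω, M 0 ω ^ (2 * (q + 1)) ∂P +
      ∑ k ∈ Finset.range n, c (k + 1) *
        (∫ ω, M (k + 1) ω ^ (2 * (q + 1)) ∂P - ∫ ω, M k ω ^ (2 * (q + 1)) ∂P) := by
  have := hM.isProbabilityMeasure
  wlog hm : ∀ i, Measurable (M i) generalizing M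
  · have hae : ∀ i, M i =ᵐ[P] (hM.aemeasurable i).mk := fun i => (hM.aemeasurable i).ae_eq_mk
    have key := this (M := fun i => (hM.aemeasurable i).mk) (hM.congr hae)
      (fun i => by rw [← integral_congr_ae (hae i), h0 i])
      (fun n i hi => by
        rw [← horth n i hi]
        refine integral_congr_ae ?_
        filter_upwards [hae i, hae (n + 1), hae n] with ω h1 h2 h3
        rw [h1, h2, h3])
      (fun i => (hM.aemeasurable i).measurable_mk)
    have hpow : ∀ i, ∫ ω, M i ω ^ (2 * (q + 1)) ∂P =
        ∫ ω, (hM.aemeasurable i).mk (M i) ω ^ (2 * (q + 1)) ∂P := fun i =>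
      integral_congr_ae ((hae i).mono fun ω h => by simp only [h])
    have hset : P.real {ω | ∃ i ≤ n, ε ≤ c i * M i ω ^ (2 * (q + 1))} =
        P.real {ω | ∃ i ≤ n, ε ≤ c i * (hM.aemeasurable i).mk (M i) ω ^ (2 * (q + 1))} := by
      refine measureReal_congr ?_
      filter_upwards [ae_all_iff.2 hae] with ω hω
      change (∃ i ≤ n, _) = (∃ i ≤ n, _)
      simp only [hω]
    simp only [hpow, hset]
    exact key
  have hset : {ω | ∃ i ≤ n, ε ≤ c i * M i ω ^ (2 * (q + 1))} =
      {ω | ∀ i ≤ n, c i * M i ω ^ (2 * (q + 1)) < ε}ᶜ := by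
    ext; simp
  rw [hset]
  refine hajekRenyi_maximal_ineq (Y := fun i ω => M i ω ^ (2 * (q + 1)))
    (fun i => (hm i).pow_const _)
    (fun i => HasGaussianLaw.integrable_pow (hM.hasGaussianLaw_eval i) _)
    (fun i ω => (even_two_mul _).pow_nonneg _) hc hc0 (fun n => ?_) n
  let S : Set (Finset.Iic n → ℝ) := (⋂ i : Finset.Iic n, {x | c i * x i ^ (2 * (q + 1)) < ε})ᶜ
  have hS : MeasurableSet S := MeasurableSet.compl <| MeasurableSet.iInter fun i =>
    measurableSet_lt (by fun_prop) measurable_const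
  have hSeq : {ω | ∀ i ≤ n, c i * M i ω ^ (2 * (q + 1)) < ε}ᶜ =
      {ω | (fun i : Finset.Iic n => M i ω) ∈ S} := by
    ext; simp [S]
  rw [hSeq]
  exact IsGaussianProcess.setIntegral_even_pow_le hM h0 n q (horth n) hS
    (measurableSet_preimage (measurable_pi_lambda _ fun i => hm i) hS)

theorem exp_neg_mul_pow_sub_pow_le {A τ : ℝ → ℝ} {β D T₀ : ℝ} {q : ℕ}
    (hA : MonotoneOn A (Ici 0)) (hτ : ∀ t > 0, HasDerivAt τ (exp (2 * A t)) t)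
    (hτ0 : ∀ t ≥ 0, 0 ≤ τ t) (hT₀ : 1 ≤ T₀) (hD : 0 ≤ D) (hq : 2 ≤ β * q)
    (hdecay : ∀ t ≥ T₀, τ t ≤ D * t ^ (-β) * exp (2 * A t)) {a b : ℝ} (ha : T₀ ≤ a) (hab : a ≤ b) :
    exp (-A b) ^ (2 * (q + 1)) * (τ b ^ (q + 1) - τ a ^ (q + 1)) ≤
      (q + 1) * D ^ q * (1 / a - 1 / b) := by
  set K : ℝ := (q + 1) * D ^ q * exp (A b) ^ (2 * (q + 1)) with hK
  have hder : ∀ t ∈ Icc a b, HasDerivAt (fun t => K * (-t⁻¹) - τ t ^ (q + 1))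
      (K * (t ^ 2)⁻¹ - (q + 1) * τ t ^ q * exp (2 * A t)) t := fun t ht => by
    have ht0 : 0 < t := by linarith [ht.1]
    simpa using! (((hasDerivAt_inv ht0.ne').neg.const_mul K).sub ((hτ t ht0).pow (q + 1)))
  have hmono : MonotoneOn (fun t => K * (-t⁻¹) - τ t ^ (q + 1)) (Icc a b) := by
    refine monotoneOn_of_deriv_nonneg (convex_Icc a b)
      (fun t ht => (hder t ht).continuousAt.continuousWithinAt)
      (fun t ht => (hder t (interior_subset ht)).differentiableAt.differentiableWithinAt)
      fun t ht => ?_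
    have ht := interior_subset ht
    rw [(hder t ht).deriv, sub_nonneg]
    have ht1 : 1 ≤ t := by linarith [ht.1]
    have h1 : τ t ^ q ≤ D ^ q * (t ^ 2)⁻¹ * exp (2 * A t) ^ q := by
      calc τ t ^ q ≤ (D * t ^ (-β) * exp (2 * A t)) ^ q :=
            pow_le_pow_left₀ (hτ0 t (by linarith)) (hdecay t (by linarith [ht.1])) q
        _ = D ^ q * t ^ (-β * q) * exp (2 * A t) ^ q := by
            rw [mul_pow, mul_pow, ← rpow_natCast (t ^ (-β)), ← rpow_mul (by linarith)]
        _ ≤ _ := by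
            gcongr
            rw [← rpow_natCast t 2, ← rpow_neg (by linarith)]
            exact rpow_le_rpow_of_exponent_le ht1 (by push_cast; linarith)
    have h2 : exp (2 * A t) ^ q * exp (2 * A t) ≤ exp (A b) ^ (2 * (q + 1)) := by
      rw [← pow_succ, two_mul, exp_add, ← pow_two, ← pow_mul]
      gcongr
      exact hA (by simp; linarith) (by simp; linarith [ht.2]) ht.2
    calc (q + 1) * τ t ^ q * exp (2 * A t)
        ≤ (q + 1) * (D ^ q * (t ^ 2)⁻¹ * exp (2 * A t) ^ q) * exp (2 * A t) := by gcongr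
      _ = (q + 1) * D ^ q * (t ^ 2)⁻¹ * (exp (2 * A t) ^ q * exp (2 * A t)) := by ring
      _ ≤ (q + 1) * D ^ q * (t ^ 2)⁻¹ * exp (A b) ^ (2 * (q + 1)) := by gcongr
      _ = K * (t ^ 2)⁻¹ := by rw [hK]; ring
  have h := hmono (left_mem_Icc.2 hab) (right_mem_Icc.2 hab) hab
  simp only at h
  calc exp (-A b) ^ (2 * (q + 1)) * (τ b ^ (q + 1) - τ a ^ (q + 1))
      ≤ exp (-A b) ^ (2 * (q + 1)) * (K * (a⁻¹ - b⁻¹)) := by gcongr; linarith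
    _ = (exp (-A b) * exp (A b)) ^ (2 * (q + 1)) * ((q + 1) * D ^ q * (a⁻¹ - b⁻¹)) := by
        rw [hK]; ring
    _ = _ := by rw [← exp_add]; simp

theorem bridge_maximal_ineq {Ω : Type*} [MeasurableSpace Ω] {P : Measure Ω}
    {X : ℝ → Ω → ℝ} {A τ : ℝ → ℝ} {β D T₀ : ℝ} {q : ℕ}
    (hX : IsGaussianProcess (fun t : Ici (0 : ℝ) => X t) P)
    (hmean : ∀ t ≥ 0, ∫ ω, X t ω ∂P = 0)
    (hcov : ∀ s ≥ 0, ∀ t ≥ 0, ∫ ω, X s ω * X t ω ∂P = exp (-A s - A t) * τ (min s t))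
    (hA : MonotoneOn A (Ici 0)) (hτ : ∀ t > 0, HasDerivAt τ (exp (2 * A t)) t)
    (hτ0 : ∀ t ≥ 0, 0 ≤ τ t) (hT₀ : 1 ≤ T₀) (hD : 0 ≤ D) (hq : 2 ≤ β * q)
    (hdecay : ∀ t ≥ T₀, τ t ≤ D * t ^ (-β) * exp (2 * A t))
    {T h δ : ℝ} (hT : T₀ ≤ T) (hh : 0 ≤ h) (n : ℕ) :
    δ * P.real {ω | ∃ i ≤ n, δ ≤ X (T + (i : ℕ) * h) ω ^ (2 * (q + 1))} ≤
      (∫ x, x ^ (2 * (q + 1)) ∂(gaussianReal 0 1)) *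
        ((D * T ^ (-β)) ^ (q + 1) + (q + 1) * D ^ q * (1 / T)) := by
  set t : ℕ → ℝ := fun i => T + i * h with ht
  have htT : ∀ i, T₀ ≤ t i := fun i => by
    have : 0 ≤ (i : ℝ) * h := by positivity
    simp only [ht]; linarith
  have ht0 : ∀ i, 0 ≤ t i := fun i => by linarith [htT i]
  have htm : Monotone t := fun i j hij => by simp only [ht]; gcongr
  let M : ℕ → Ω → ℝ := fun i ω => exp (A (t i)) * X (t i) ω
  have hM : IsGaussianProcess M P :=
    (hX.comp_right fun i : ℕ => (⟨t i, ht0 i⟩ : Ici (0 : ℝ))).smul fun i => exp (A (t i))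
  have hM0 : ∀ i, ∫ ω, M i ω ∂P = 0 := fun i => by
    simp only [M, integral_const_mul, hmean _ (ht0 i), mul_zero]
  have hMM : ∀ i j, i ≤ j → ∫ ω, M i ω * M j ω ∂P = τ (t i) := fun i j hij => by
    have : ∀ ω, M i ω * M j ω = exp (A (t i) + A (t j)) * (X (t i) ω * X (t j) ω) := fun ω => by
      simp only [M, exp_add]; ring
    simp only [this, integral_const_mul, hcov _ (ht0 i) _ (ht0 j), min_eq_left (htm hij)]
    rw [← mul_assoc, ← exp_add]
    simp
  have hint : ∀ i j, Integrable (fun ω => M i ω * M j ω) P := fun i j =>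
    (hM.hasGaussianLaw_eval i).memLp_two.integrable_mul (hM.hasGaussianLaw_eval j).memLp_two
  have horth : ∀ n, ∀ i ≤ n, ∫ ω, M i ω * (M (n + 1) ω - M n ω) ∂P = 0 := fun n i hi => by
    simp only [mul_sub]
    rw [integral_sub (hint _ _) (hint _ _), hMM i (n + 1) (by lia), hMM i n hi, sub_self]
  have hmom : ∀ i, ∫ ω, M i ω ^ (2 * (q + 1)) ∂P =
      (∫ x, x ^ (2 * (q + 1)) ∂(gaussianReal 0 1)) * τ (t i) ^ (q + 1) := fun i => by
    rw [HasGaussianLaw.integral_even_pow (hM.hasGaussianLaw_eval i) (hM0 i), hMM i i le_rfl]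
  have hC : 0 ≤ ∫ x : ℝ, x ^ (2 * (q + 1)) ∂(gaussianReal 0 1) :=
    integral_nonneg fun x => (even_two_mul _).pow_nonneg _
  set C := ∫ x : ℝ, x ^ (2 * (q + 1)) ∂(gaussianReal 0 1)
  have key := IsGaussianProcess.maximal_ineq hM hM0 horth
    (c := fun i => exp (-A (t i)) ^ (2 * (q + 1)))
    (fun i j hij => by
      have := hA (ht0 i) (ht0 j) (htm hij)
      simp only
      gcongr)
    (fun i => by positivity) q δ n
  have hcM : ∀ i ω, exp (-A (t i)) ^ (2 * (q + 1)) * M i ω ^ (2 * (q + 1)) =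
      X (t i) ω ^ (2 * (q + 1)) := fun i ω => by
    rw [← mul_pow]
    simp only [M]
    rw [← mul_assoc, ← exp_add]
    simp
  simp only [hcM, hmom] at key
  refine key.trans ?_
  have ht00 : t 0 = T := by simp [ht]
  have h1 : exp (-A (t 0)) ^ (2 * (q + 1)) * (C * τ (t 0) ^ (q + 1)) ≤
      C * (D * T ^ (-β)) ^ (q + 1) := by
    rw [ht00, mul_left_comm, pow_mul, ← mul_pow]
    have h2 := hdecay T hT
    have h3 := hτ0 T (by linarith)
    refine mul_le_mul_of_nonneg_left (pow_le_pow_left₀ (by positivity) ?_ _) hC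
    calc exp (-A T) ^ 2 * τ T ≤ exp (-A T) ^ 2 * (D * T ^ (-β) * exp (2 * A T)) := by gcongr
      _ = D * T ^ (-β) * (exp (-A T) ^ 2 * exp (2 * A T)) := by ring
      _ = D * T ^ (-β) := by rw [← exp_nat_mul, ← exp_add]; simp
  have h2 : ∑ k ∈ Finset.range n, exp (-A (t (k + 1))) ^ (2 * (q + 1)) *
      (C * τ (t (k + 1)) ^ (q + 1) - C * τ (t k) ^ (q + 1)) ≤
      C * ((q + 1) * D ^ q * (1 / T)) := by
    calc _ ≤ ∑ k ∈ Finset.range n, C * ((q + 1) * D ^ q) * (1 / t k - 1 / t (k + 1)) := by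
          refine Finset.sum_le_sum fun k _ => ?_
          have := exp_neg_mul_pow_sub_pow_le hA hτ hτ0 hT₀ hD hq hdecay (htT k) (htm k.le_succ)
          rw [← mul_sub, mul_left_comm, mul_assoc]
          exact mul_le_mul_of_nonneg_left this hC
      _ = C * ((q + 1) * D ^ q) * (1 / t 0 - 1 / t n) := by
          rw [← Finset.mul_sum, Finset.sum_range_sub' (fun k => 1 / t k)]
      _ ≤ C * ((q + 1) * D ^ q) * (1 / T) := by
          have : 0 ≤ 1 / t n := one_div_nonneg.2 (ht0 n)
          rw [ht00]
          gcongr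
          linarith
      _ = _ := by ring
  linarith

/-- A continuous path bounded on all dyadic translates of `N` is bounded on `[N, ∞)`. -/
theorem ContinuousOn.le_of_le_dyadic {f : ℝ → ℝ} {N δ : ℝ} (hf : ContinuousOn f (Ici N))
    (hδ : ∀ m : ℕ, ∀ i ≤ 4 ^ m, f (N + (i : ℕ) * (1 / 2 ^ m)) ≤ δ) {t : ℝ} (ht : N < t) :
    f t ≤ δ := by
  have hlim : Tendsto (fun m : ℕ => N + (⌊(t - N) * 2 ^ m⌋₊ : ℝ) * (1 / 2 ^ m)) atTop (nhds t) := by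
    have h1 : Tendsto (fun m : ℕ => (2 : ℝ) ^ m) atTop atTop :=
      tendsto_pow_atTop_atTop_of_one_lt (by norm_num)
    have h2 := (tendsto_nat_floor_mul_div_atTop (sub_nonneg.2 ht.le)).comp h1
    simpa [Function.comp_def, div_eq_mul_inv] using h2.const_add N
  have hft : Tendsto (fun m : ℕ => f (N + (⌊(t - N) * 2 ^ m⌋₊ : ℝ) * (1 / 2 ^ m))) atTop
      (nhds (f t)) := ((hf.continuousAt (Ici_mem_nhds ht)).tendsto).comp hlim
  refine le_of_tendsto hft ?_
  have h3 : ∀ᶠ m : ℕ in atTop, t - N ≤ 2 ^ m :=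
    (tendsto_pow_atTop_atTop_of_one_lt (by norm_num)).eventually_ge_atTop _
  filter_upwards [h3] with m hm
  refine hδ m _ (Nat.floor_le_of_le ?_)
  push_cast
  calc (t - N) * 2 ^ m ≤ 2 ^ m * 2 ^ m := by gcongr
    _ = 4 ^ m := by rw [← mul_pow]; norm_num

theorem bridge_tendsto_zero {Ω : Type*} [MeasurableSpace Ω] {P : Measure Ω}
    {X : ℝ → Ω → ℝ} {A τ : ℝ → ℝ} {β D T₀ : ℝ}
    (hX : IsGaussianProcess (fun t : Ici (0 : ℝ) => X t) P)
    (hmean : ∀ t ≥ 0, ∫ ω, X t ω ∂P = 0)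
    (hcov : ∀ s ≥ 0, ∀ t ≥ 0, ∫ ω, X s ω * X t ω ∂P = exp (-A s - A t) * τ (min s t))
    (hA : MonotoneOn A (Ici 0)) (hτ : ∀ t > 0, HasDerivAt τ (exp (2 * A t)) t)
    (hτ0 : ∀ t ≥ 0, 0 ≤ τ t) (hT₀ : 1 ≤ T₀) (hD : 0 ≤ D) (hβ : 0 < β)
    (hdecay : ∀ t ≥ T₀, τ t ≤ D * t ^ (-β) * exp (2 * A t))
    (hpath : ∀ᵐ ω ∂P, ContinuousOn (fun t => X t ω) (Ici 0)) :
    ∀ᵐ ω ∂P, Tendsto (fun t : ℝ => X t ω) atTop (nhds 0) := by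
  have := hX.isProbabilityMeasure
  obtain ⟨q, hq⟩ : ∃ q : ℕ, 2 ≤ β * q := by
    obtain ⟨q, hq⟩ := exists_nat_ge (2 / β)
    exact ⟨q, by rwa [div_le_iff₀' hβ] at hq⟩
  set R : ℝ → ℝ := fun T => (∫ x, x ^ (2 * (q + 1)) ∂(gaussianReal 0 1)) *
    ((D * T ^ (-β)) ^ (q + 1) + (q + 1) * D ^ q * (1 / T)) with hR
  have hR0 : Tendsto R atTop (nhds 0) := by
    have h1 := ((tendsto_rpow_neg_atTop hβ).const_mul D).pow (q + 1)
    have h2 : Tendsto (fun T : ℝ => 1 / T) atTop (nhds 0) := by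
      simpa using tendsto_inv_atTop_zero (𝕜 := ℝ)
    simpa [hR] using (h1.add (h2.const_mul ((q + 1) * D ^ q))).const_mul
      (∫ x, x ^ (2 * (q + 1)) ∂(gaussianReal 0 1))
  let F : ℝ → ℕ → ℕ → Set Ω := fun δ N m =>
    {ω | ∃ i ≤ 4 ^ m, δ ≤ X (N + (i : ℕ) * (1 / 2 ^ m)) ω ^ (2 * (q + 1))}
  have hFmono : ∀ δ N, Monotone (F δ N) := fun δ N => by
    refine monotone_nat_of_le_succ fun m ω => ?_
    rintro ⟨i, hi, h⟩
    refine ⟨2 * i, by rw [pow_succ]; lia, ?_⟩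
    have : (N : ℝ) + ((2 * i : ℕ) : ℝ) * (1 / 2 ^ (m + 1)) = N + i * (1 / 2 ^ m) := by
      push_cast; field_simp; ring
    rwa [this]
  have hG : ∀ δ > 0, ∀ N : ℕ, T₀ ≤ N → P (⋃ m, F δ N m) ≤ ENNReal.ofReal (R N / δ) := by
    intro δ hδ N hN
    rw [(hFmono δ N).measure_iUnion]
    refine iSup_le fun m => ?_
    rw [← ofReal_measureReal]
    refine ENNReal.ofReal_le_ofReal ?_
    rw [le_div_iff₀' hδ]
    exact bridge_maximal_ineq hX hmean hcov hA hτ hτ0 hT₀ hD hq hdecay hN (by positivity) _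
  have hnull : ∀ δ > 0, P (⋂ N, ⋃ m, F δ N m) = 0 := by
    intro δ hδ
    have hlim : Tendsto (fun N : ℕ => ENNReal.ofReal (R N / δ)) atTop (nhds 0) := by
      simpa using ENNReal.tendsto_ofReal
        ((hR0.comp tendsto_natCast_atTop_atTop).div_const δ)
    refine le_antisymm (ge_of_tendsto hlim ?_) zero_le
    filter_upwards [tendsto_natCast_atTop_atTop.eventually_ge_atTop T₀] with N hN
    exact (measure_mono (iInter_subset _ N)).trans (hG δ hδ N hN)
  have hae : ∀ᵐ ω ∂P, ∀ j : ℕ, ω ∉ ⋂ N, ⋃ m, F ((1 / (j + 1 : ℝ)) ^ (2 * (q + 1))) N m :=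
    ae_all_iff.2 fun j => measure_eq_zero_iff_ae_notMem.1 (hnull _ (by positivity))
  filter_upwards [hae, hpath] with ω hω hc
  refine Metric.tendsto_atTop.2 fun ε hε => ?_
  obtain ⟨j, hj⟩ := exists_nat_one_div_lt hε
  have hj' := hω j
  simp only [mem_iInter, mem_iUnion, not_forall, not_exists] at hj'
  obtain ⟨N, hN⟩ := hj'
  refine ⟨N + 1, fun t ht => ?_⟩
  have hle : X t ω ^ (2 * (q + 1)) ≤ (1 / (j + 1 : ℝ)) ^ (2 * (q + 1)) := by
    refine ContinuousOn.le_of_le_dyadic (f := fun t => X t ω ^ (2 * (q + 1))) (N := N)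
      ((hc.mono (Ici_subset_Ici.2 N.cast_nonneg)).pow _) (fun m i hi => ?_) (by linarith)
    by_contra! hlt
    exact hN m ⟨i, hi, hlt.le⟩
  rw [Real.dist_eq, sub_zero]
  refine lt_of_le_of_lt ?_ hj
  rw [← (even_two_mul (q + 1)).pow_abs] at hle
  exact (pow_le_pow_iff_left₀ (abs_nonneg _) (by positivity) (by simp)).1 hle

theorem exists_le_rpow_neg_mul_exp {α A τ : ℝ → ℝ} {β c : ℝ} (hβ : 0 < β) (hc : 0 < c)
    (hα : ∀ t > 0, c * t ^ β ≤ α t) (hA : ∀ t > 0, HasDerivAt A (α t) t)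
    (hτ : ∀ t > 0, HasDerivAt τ (exp (2 * A t)) t) :
    ∃ D T₀ : ℝ, 1 ≤ T₀ ∧ 0 ≤ D ∧ ∀ t ≥ T₀, τ t ≤ D * t ^ (-β) * exp (2 * A t) := by
  set T₀ : ℝ := max 1 (β / c) with hT₀
  set D : ℝ := max (1 / c) (τ T₀ * T₀ ^ β * exp (-(2 * A T₀))) with hD
  have hT₀1 : 1 ≤ T₀ := le_max_left _ _
  have hDc : 1 ≤ D * c := by
    rw [← div_le_iff₀ hc]
    exact le_max_left _ _
  have hD0 : 0 ≤ D := (by positivity : 0 ≤ 1 / c).trans (le_max_left _ _)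
  refine ⟨D, T₀, hT₀1, hD0, fun t ht => ?_⟩
  have hder : ∀ s ∈ Ici T₀, HasDerivAt (fun s => D * s ^ (-β) * exp (2 * A s) - τ s)
      (D * (-β * s ^ (-β - 1)) * exp (2 * A s) +
        D * s ^ (-β) * (exp (2 * A s) * (2 * α s)) - exp (2 * A s)) s := fun s hs => by
    have hs0 : 0 < s := by linarith [mem_Ici.1 hs]
    exact ((((hasDerivAt_rpow_const (Or.inl hs0.ne')).const_mul D).mul
      (((hA s hs0).const_mul 2).exp)).sub (hτ s hs0))
  have hmono : MonotoneOn (fun s => D * s ^ (-β) * exp (2 * A s) - τ s) (Ici T₀) := by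
    refine monotoneOn_of_deriv_nonneg (convex_Ici T₀)
      (fun s hs => (hder s hs).continuousAt.continuousWithinAt)
      (fun s hs => (hder s (interior_subset hs)).differentiableAt.differentiableWithinAt)
      fun s hs => ?_
    have hs := interior_subset hs
    rw [(hder s hs).deriv]
    have hs' : T₀ ≤ s := hs
    have hs1 : 1 ≤ s := hT₀1.trans hs'
    have hs0 : 0 < s := by linarith
    have h1 : c ≤ s ^ (-β) * α s := by
      calc c = s ^ (-β) * (c * s ^ β) := by
            rw [mul_left_comm, ← rpow_add hs0]; simp
        _ ≤ _ := by have := hα s hs0; gcongr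
    have h2 : β * s ^ (-β - 1) ≤ c := by
      calc β * s ^ (-β - 1) ≤ β * s ^ (-1 : ℝ) := by gcongr; linarith
        _ = β / s := by rw [rpow_neg_one]; rfl
        _ ≤ c := by
            rw [div_le_comm₀ hs0 hc]
            exact (le_max_right _ _).trans hs'
    have h3 : 0 ≤ D * (2 * (s ^ (-β) * α s) - β * s ^ (-β - 1)) - 1 := by
      have : D * c ≤ D * (2 * (s ^ (-β) * α s) - β * s ^ (-β - 1)) := by gcongr; linarith
      linarith
    have := mul_nonneg h3 (exp_pos (2 * A s)).le
    linarith
  have h0 : 0 ≤ D * T₀ ^ (-β) * exp (2 * A T₀) - τ T₀ := by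
    have hT0 : 0 < T₀ := by linarith
    rw [sub_nonneg]
    calc τ T₀ = τ T₀ * T₀ ^ β * exp (-(2 * A T₀)) * T₀ ^ (-β) * exp (2 * A T₀) := by
          rw [rpow_neg hT0.le, exp_neg]
          field_simp
      _ ≤ _ := by gcongr; exact le_max_right _ _
  have := hmono self_mem_Ici ht ht
  simp only at this
  linarith

theorem GrowthCond.exists_mul_rpow_le {α : ℝ → ℝ} {γ β : ℝ} (h : GrowthCond α γ β)
    (hpos : ∀ t ≥ (0 : ℝ), 0 < α t) (hcont : ContinuousOn α (Ici 0)) :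
    ∃ c > 0, ∀ t > 0, c * t ^ β ≤ α t := by
  obtain ⟨-, ⟨hγ, -⟩, -, ⟨C, hC, hle⟩, -⟩ := h
  refine ⟨α 0 ^ (2 * γ) / C, div_pos (rpow_pos_of_pos (hpos 0 le_rfl) _) hC, fun t ht => ?_⟩
  have hbdd : BddAbove (α '' Icc 0 (t + 1)) :=
    (isCompact_Icc.image_of_continuousOn (hcont.mono Icc_subset_Ici_self)).bddAbove
  have h0 : α 0 ≤ alphaStar α (t + 1) :=
    le_csSup hbdd (mem_image_of_mem α (left_mem_Icc.2 (by linarith)))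
  have h1 : α 0 ^ (2 * γ) ≤ alphaStar α (t + 1) ^ (2 * γ) :=
    rpow_le_rpow (hpos 0 le_rfl).le h0 (by linarith)
  have h2 := hle t ht
  rw [div_le_iff₀ (hpos t ht.le), rpow_neg ht.le] at h2
  have h3 : 0 < t ^ β := rpow_pos_of_pos ht _
  rw [div_mul_eq_mul_div, div_le_iff₀ hC, mul_comm (α t)]
  calc α 0 ^ (2 * γ) * t ^ β ≤ C * (t ^ β)⁻¹ * α t * t ^ β := by gcongr; linarith
    _ = C * α t := by field_simp

theorem IsBridge.isGaussianProcess {Ω : Type*} [MeasurableSpace Ω] {P : Measure Ω}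
    {α : ℝ → ℝ} {X : ℝ → Ω → ℝ} (hX : IsBridge P α X) :
    IsGaussianProcess (fun t : Ici (0 : ℝ) => X t) P := by
  have hm : ∀ t ≥ 0, AEMeasurable (X t) P := fun t ht => by
    obtain ⟨v, hv⟩ := hX.1 1 (fun _ => 1) (fun _ => t) fun _ => ht
    refine AEMeasurable.of_map_ne_zero (f := X t) ?_
    simp only [Finset.univ_unique, Finset.sum_const, Finset.card_singleton, one_mul,
      one_smul] at hv
    rw [hv]
    exact IsProbabilityMeasure.ne_zero _
  refine ⟨fun I => ⟨isGaussian_of_map_eq_gaussianReal fun L => ?_⟩⟩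
  have hI : AEMeasurable (fun ω => I.restrict fun t : Ici (0 : ℝ) => X t ω) P :=
    aemeasurable_pi_lambda _ fun i => hm _ i.1.2
  obtain ⟨v, hv⟩ := hX.1 _ (fun j => L (Pi.single (I.equivFin.symm j) 1))
    (fun j => ((I.equivFin.symm j).1 : ℝ)) fun j => (I.equivFin.symm j).1.2
  refine ⟨0, v, ?_⟩
  rw [AEMeasurable.map_map_of_aemeasurable (by fun_prop) hI, ← hv]
  congr 1 with ω
  rw [Equiv.sum_comp I.equivFin.symm (fun i => L (Pi.single i 1) * X i ω)]
  simp only [Function.comp_apply]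
  conv_lhs => rw [pi_eq_sum_univ' (I.restrict fun t : Ici (0 : ℝ) => X t ω)]
  simp [mul_comm]

theorem IsBridge.integral_eq_zero {Ω : Type*} [MeasurableSpace Ω] {P : Measure Ω}
    {α : ℝ → ℝ} {X : ℝ → Ω → ℝ} (hX : IsBridge P α X) {t : ℝ} (ht : 0 ≤ t) :
    ∫ ω, X t ω ∂P = 0 := by
  obtain ⟨v, hv⟩ := hX.1 1 (fun _ => 1) (fun _ => t) fun _ => ht
  simp only [Finset.univ_unique, Finset.sum_const, Finset.card_singleton, one_mul,
    one_smul] at hv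
  have hm : AEMeasurable (X t) P := hX.isGaussianProcess.aemeasurable ⟨t, ht⟩
  rw [← integral_map (f := fun x : ℝ => x) hm (by fun_prop), hv, integral_id_gaussianReal]

theorem stmt_5 {Ω : Type*} [MeasurableSpace Ω] (P : Measure Ω) [IsProbabilityMeasure P]
    (α : ℝ → ℝ) (X : ℝ → Ω → ℝ)
    (hα_pos : ∀ t ≥ (0:ℝ), 0 < α t)
    (hα_cont : ContinuousOn α (Set.Ici 0))
    (hgrowth : ∃ γ β : ℝ, GrowthCond α γ β)
    (hX : IsBridge P α X)
    (hpath : ∀ᵐ ω ∂P, ContinuousOn (fun t => X t ω) (Set.Ici 0)) :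
    ∀ᵐ ω ∂P, Tendsto (fun t : ℝ => X t ω) atTop (nhds 0) := by
  obtain ⟨γ, β, hg⟩ := hgrowth
  obtain ⟨c, hc, hle⟩ := hg.exists_mul_rpow_le hα_pos hα_cont
  have hβ : 0 < β := hg.2.2.1
  -- extend `α` to a continuous function on the whole line
  let a : ℝ → ℝ := fun t => α (max t 0)
  have ha : Continuous a := hα_cont.comp_continuous (by fun_prop) fun t => mem_Ici.2 (le_max_right _ _)
  have haα : ∀ t ≥ 0, a t = α t := fun t ht => by simp only [a, max_eq_left ht]
  have haA : ∀ t ≥ 0, Aint α t = ∫ u in (0 : ℝ)..t, a u := fun t ht =>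
    intervalIntegral.integral_congr fun u hu => by
      rw [uIcc_of_le ht] at hu
      exact (haα u hu.1).symm
  let A : ℝ → ℝ := fun t => ∫ u in (0 : ℝ)..t, a u
  have hA : ∀ t, HasDerivAt A (a t) t := fun t => (ha.integral_hasStrictDerivAt 0 t).hasDerivAt
  have hAc : Continuous A := continuous_iff_continuousAt.2 fun t => (hA t).continuousAt
  let τ : ℝ → ℝ := fun t => ∫ u in (0 : ℝ)..t, exp (2 * A u)
  have hτ : ∀ t, HasDerivAt τ (exp (2 * A t)) t := fun t =>
    ((by fun_prop : Continuous fun u => exp (2 * A u)).integral_hasStrictDerivAt 0 t).hasDerivAt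
  obtain ⟨D, T₀, hT₀, hD, hdecay⟩ := exists_le_rpow_neg_mul_exp (α := a) hβ hc
    (fun t ht => (hle t ht).trans_eq (haα t ht.le).symm) (fun t _ => hA t) (fun t _ => hτ t)
  have hAm : Monotone A := monotone_of_deriv_nonneg (fun t => (hA t).differentiableAt) fun t => by
    rw [(hA t).deriv]
    exact (hα_pos _ (le_max_right _ _)).le
  refine bridge_tendsto_zero hX.isGaussianProcess (fun t ht => hX.integral_eq_zero ht)
    (fun s hs t ht => ?_) (hAm.monotoneOn _) (fun t _ => hτ t)
    (fun t ht => intervalIntegral.integral_nonneg ht fun u _ => (exp_pos _).le)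
    hT₀ hD hβ hdecay hpath
  rw [hX.2 s t hs ht, Kker, haA s hs, haA t ht]
  congr 1
  refine intervalIntegral.integral_congr fun u hu => ?_
  rw [uIcc_of_le (le_min hs ht)] at hu
  simp only [haA u hu.1, A]
end

section
/- Let α : [0,∞) → (0,∞) be continuous and let K be the associated covariance kernel. For all 0 ≤ r ≤ s, the 2×2 determinant K(r,r)K(s,s) − K(r,s)² equals exp(−2A(r) − 2A(s)) · (∫₀ʳ exp(2A(u)) du) · (∫ᵣˢ exp(2A(u)) du); moreover, for every t > 0 there is a constant c_t > 0 such that K(r,r)K(s,s) − K(r,s)² ≥ c_t · r · (s − r) for all 0 < r < s ≤ t. -/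
open MeasureTheory ProbabilityTheory Real Filter Set

theorem intervalIntegrable_of_continuousOn_Ici {f : ℝ → ℝ} {c a b : ℝ}
    (hf : ContinuousOn f (Set.Ici c)) (ha : c ≤ a) (hb : c ≤ b) :
    IntervalIntegrable f volume a b :=
  (hf.mono fun _ hx => (le_min ha hb).trans hx.1).intervalIntegrable

theorem Aint_add_integral {α : ℝ → ℝ} (hα : ContinuousOn α (Set.Ici 0)) {a b : ℝ}
    (ha : 0 ≤ a) (hb : 0 ≤ b) : Aint α a + ∫ u in a..b, α u = Aint α b :=
  intervalIntegral.integral_add_adjacent_intervals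
    (intervalIntegrable_of_continuousOn_Ici hα le_rfl ha)
    (intervalIntegrable_of_continuousOn_Ici hα ha hb)

theorem Aint_le_Aint {α : ℝ → ℝ} (hα : ContinuousOn α (Set.Ici 0))
    (hα_nonneg : ∀ t ≥ (0 : ℝ), 0 ≤ α t) {a b : ℝ} (ha : 0 ≤ a) (hab : a ≤ b) :
    Aint α a ≤ Aint α b := by
  rw [← Aint_add_integral hα ha (ha.trans hab)]
  exact le_add_of_nonneg_right
    (intervalIntegral.integral_nonneg hab fun u hu => hα_nonneg u (ha.trans hu.1))

theorem Aint_nonneg {α : ℝ → ℝ} (hα_nonneg : ∀ t ≥ (0 : ℝ), 0 ≤ α t) {t : ℝ} (ht : 0 ≤ t) :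
    0 ≤ Aint α t :=
  intervalIntegral.integral_nonneg ht fun u hu => hα_nonneg u hu.1

theorem intervalIntegrable_exp_two_mul_Aint {α : ℝ → ℝ} (hα : ContinuousOn α (Set.Ici 0))
    {a b : ℝ} (ha : 0 ≤ a) (hb : 0 ≤ b) :
    IntervalIntegrable (fun u => Real.exp (2 * Aint α u)) volume a b := by
  have hA : ContinuousOn (Aint α) (Set.uIcc 0 (max a b)) :=
    intervalIntegral.continuousOn_primitive_interval
      ((intervalIntegrable_iff' (by simp)).1
        (intervalIntegrable_of_continuousOn_Ici hα le_rfl (ha.trans (le_max_left a b))))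
  refine ContinuousOn.intervalIntegrable ?_
  refine ((continuousOn_const.mul hA).rexp).mono ?_
  rw [Set.uIcc_of_le (ha.trans (le_max_left a b))]
  exact Set.Icc_subset_Icc_left (le_min ha hb)

theorem sub_le_integral_exp_two_mul_Aint {α : ℝ → ℝ} (hα : ContinuousOn α (Set.Ici 0))
    (hα_nonneg : ∀ t ≥ (0 : ℝ), 0 ≤ α t) {a b : ℝ} (ha : 0 ≤ a) (hab : a ≤ b) :
    b - a ≤ ∫ u in a..b, Real.exp (2 * Aint α u) := by
  calc b - a = ∫ _ in a..b, (1 : ℝ) := by simp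
    _ ≤ _ := intervalIntegral.integral_mono_on hab intervalIntegrable_const
      (intervalIntegrable_exp_two_mul_Aint hα ha (ha.trans hab)) fun u hu =>
        Real.one_le_exp (mul_nonneg zero_le_two (Aint_nonneg hα_nonneg (ha.trans hu.1)))

theorem Kker_det_eq {α : ℝ → ℝ} (hα : ContinuousOn α (Set.Ici 0)) {r s : ℝ}
    (hr : 0 ≤ r) (hrs : r ≤ s) :
    Kker α r r * Kker α s s - (Kker α r s) ^ 2 =
      Real.exp (-(2 * Aint α r) - 2 * Aint α s) *
        (∫ u in (0 : ℝ)..r, Real.exp (2 * Aint α u)) *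
        (∫ u in r..s, Real.exp (2 * Aint α u)) := by
  have hadd := intervalIntegral.integral_add_adjacent_intervals
    (intervalIntegrable_exp_two_mul_Aint hα le_rfl hr)
    (intervalIntegrable_exp_two_mul_Aint hα hr (hr.trans hrs))
  have hdiag : Real.exp (-(2 * Aint α r) - 2 * Aint α s) =
      Real.exp (-(Aint α r) - Aint α r) * Real.exp (-(Aint α s) - Aint α s) := by
    rw [← Real.exp_add]; ring_nf
  have hoff : Real.exp (-(2 * Aint α r) - 2 * Aint α s) =
      Real.exp (-(Aint α r) - Aint α s) ^ 2 := by
    rw [sq, ← Real.exp_add]; ring_nf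
  simp only [Kker, min_self, min_eq_left hrs]
  rw [mul_pow, ← hoff, mul_mul_mul_comm, ← hdiag, ← hadd]
  ring

theorem stmt_6 (α : ℝ → ℝ)
    (hα_pos : ∀ t ≥ (0:ℝ), 0 < α t)
    (hα_cont : ContinuousOn α (Set.Ici 0)) :
    (∀ r s : ℝ, 0 ≤ r → r ≤ s →
      Kker α r r * Kker α s s - (Kker α r s)^2 =
        Real.exp (-(2 * Aint α r) - 2 * Aint α s) *
          (∫ u in (0:ℝ)..r, Real.exp (2 * Aint α u)) *
          (∫ u in r..s, Real.exp (2 * Aint α u))) ∧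
    (∀ t > (0:ℝ), ∃ c > (0:ℝ), ∀ r s : ℝ, 0 < r → r < s → s ≤ t →
      c * r * (s - r) ≤ Kker α r r * Kker α s s - (Kker α r s)^2) := by
  refine ⟨fun r s hr hrs => Kker_det_eq hα_cont hr hrs, fun t _ =>
    ⟨Real.exp (-(4 * Aint α t)), Real.exp_pos _, fun r s hr hrs hst => ?_⟩⟩
  have hα_nonneg : ∀ t ≥ (0 : ℝ), 0 ≤ α t := fun t ht => (hα_pos t ht).le
  have hAr := Aint_le_Aint hα_cont hα_nonneg hr.le (hrs.le.trans hst)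
  have hAs := Aint_le_Aint hα_cont hα_nonneg (hr.trans hrs).le hst
  have hIr := sub_le_integral_exp_two_mul_Aint hα_cont hα_nonneg le_rfl hr.le
  have hIrs := sub_le_integral_exp_two_mul_Aint hα_cont hα_nonneg hr.le hrs.le
  rw [sub_zero] at hIr
  rw [Kker_det_eq hα_cont hr.le hrs.le]
  have hexp : Real.exp (-(4 * Aint α t)) ≤ Real.exp (-(2 * Aint α r) - 2 * Aint α s) :=
    Real.exp_le_exp.2 (by linarith)
  exact mul_le_mul (mul_le_mul hexp hIr hr.le (Real.exp_pos _).le) hIrs (sub_nonneg.2 hrs.le)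
    (mul_nonneg (Real.exp_pos _).le (hr.le.trans hIr))
end

section
/- Let (X_t)_{t≥0} be an infinite time horizon Brownian bridge with jointly measurable sample paths whose coefficient α is continuous and positive. Then for every t > 0 and all ε, θ > 0, E[ L⁰_{t,ε} · L⁰_{t,θ} ] = (1/(2π)) ∫₀ᵗ ∫₀ᵗ [ (K(s,s) + θ)(K(r,r) + ε) − K(r,s)² ]^{−1/2} dr ds, where L⁰_{t,ε} = ∫₀ᵗ (2πε)^{−1/2} exp(−X_r²/(2ε)) dr. -/
open MeasureTheory ProbabilityTheory Real Filter Set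

lemma integrable_exp_neg_quadForm {a b c : ℝ} (ha : 0 < a) (hc : 0 < c)
    (hdet : 0 < a * c - b ^ 2) :
    Integrable (fun z : ℝ × ℝ => exp (-(a * z.1 ^ 2 + 2 * b * z.1 * z.2 + c * z.2 ^ 2) / 2)) := by
  set l := (a * c - b ^ 2) / (a + c) / 2 with hl
  have hl0 : 0 < l := by positivity
  have hF := (integrable_exp_neg_mul_sq hl0).mul_prod (integrable_exp_neg_mul_sq hl0)
  refine hF.mono' (by fun_prop) (ae_of_all _ fun z => ?_)
  rw [Real.norm_eq_abs, abs_of_pos (exp_pos _), ← Real.exp_add, exp_le_exp]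
  have hl' : l * (2 * (a + c)) = a * c - b ^ 2 := by rw [hl]; field_simp
  have hac : 0 < a + c := by positivity
  have key : (a + c) * (a * z.1 ^ 2 + 2 * b * z.1 * z.2 + c * z.2 ^ 2)
      - l * (2 * (a + c)) * (z.1 ^ 2 + z.2 ^ 2) = (a * z.1 + b * z.2) ^ 2
        + (b * z.1 + c * z.2) ^ 2 := by rw [hl']; ring
  have h2 : 0 ≤ (a + c) * ((a * z.1 ^ 2 + 2 * b * z.1 * z.2 + c * z.2 ^ 2)
      - 2 * l * (z.1 ^ 2 + z.2 ^ 2)) := by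
    have : 0 ≤ (a * z.1 + b * z.2) ^ 2 + (b * z.1 + c * z.2) ^ 2 := by positivity
    linarith
  linarith [nonneg_of_mul_nonneg_right h2 hac]

lemma integral_exp_neg_quadForm {a b c : ℝ} (ha : 0 < a) (hc : 0 < c)
    (hdet : 0 < a * c - b ^ 2) :
    ∫ z : ℝ × ℝ, exp (-(a * z.1 ^ 2 + 2 * b * z.1 * z.2 + c * z.2 ^ 2) / 2) =
      2 * π * (a * c - b ^ 2) ^ (-(1:ℝ) / 2) := by
  rw [Measure.volume_eq_prod, integral_prod _ (integrable_exp_neg_quadForm ha hc hdet)]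
  have inner (x : ℝ) : ∫ y : ℝ, exp (-(a * x ^ 2 + 2 * b * x * y + c * y ^ 2) / 2) =
      √(π / (c / 2)) * exp (-((a * c - b ^ 2) / (2 * c)) * x ^ 2) := by
    have h (y : ℝ) : exp (-(a * x ^ 2 + 2 * b * x * y + c * y ^ 2) / 2) =
        exp (-((a * c - b ^ 2) / (2 * c)) * x ^ 2) * exp (-(c / 2) * (y + b / c * x) ^ 2) := by
      rw [← Real.exp_add]
      congr 1
      field_simp
      ring
    simp_rw [h]
    rw [integral_const_mul, integral_add_right_eq_self (fun y => exp (-(c / 2) * y ^ 2)),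
      integral_gaussian, mul_comm]
  simp_rw [inner]
  rw [integral_const_mul, integral_gaussian, ← Real.sqrt_mul (by positivity),
    show π / (c / 2) * (π / ((a * c - b ^ 2) / (2 * c))) = (2 * π) ^ 2 / (a * c - b ^ 2) by
      field_simp,
    Real.sqrt_div (by positivity), Real.sqrt_sq (by positivity), neg_div, Real.rpow_neg hdet.le,
    ← Real.sqrt_eq_rpow, div_eq_mul_inv]

/-- Fourier inversion for the centered Gaussian density. -/
lemma gaussian_density_eq_fourier {ε : ℝ} (hε : 0 < ε) (x : ℝ) :
    (((√(2 * π * ε))⁻¹ * exp (-x ^ 2 / (2 * ε)) : ℝ) : ℂ) =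
      (2 * π : ℂ)⁻¹ * ∫ ξ : ℝ, Complex.exp (Complex.I * x * ξ) *
        Complex.exp (-((ε / 2 : ℝ) : ℂ) * ξ ^ 2) := by
  have hre : 0 < (((ε / 2 : ℝ) : ℂ)).re := by simpa using hε
  rw [fourierIntegral_gaussian hre]
  have h : ((π : ℂ) / ((ε / 2 : ℝ) : ℂ)) ^ (1 / 2 : ℂ) = ((√(π / (ε / 2)) : ℝ) : ℂ) := by
    rw [Real.sqrt_eq_rpow, Complex.ofReal_cpow (by positivity)]
    push_cast
    rfl
  have hs : (√(2 * π * ε))⁻¹ = (2 * π)⁻¹ * √(π / (ε / 2)) := by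
    rw [← Real.sqrt_inv, ← Real.sqrt_sq (show 0 ≤ (2 * π)⁻¹ by positivity),
      ← Real.sqrt_mul (by positivity)]
    congr 1
    field_simp
  rw [h, hs]
  push_cast
  rw [mul_assoc]
  congr 4
  ring

section GaussianPair

variable {Ω : Type*} [MeasurableSpace Ω] {P : Measure Ω} {Y Z : Ω → ℝ}

lemma memLp_two_of_map_eq_gaussianReal {v : NNReal} (hY : Measurable Y)
    (h : P.map Y = gaussianReal 0 v) : MemLp Y 2 P := by
  have := memLp_id_gaussianReal (μ := 0) (v := v) 2
  rw [← h, memLp_map_measure_iff (by fun_prop) hY.aemeasurable] at this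
  exact this

lemma integral_sq_of_map_eq_gaussianReal {v : NNReal} (hY : Measurable Y)
    (h : P.map Y = gaussianReal 0 v) : ∫ ω, Y ω ^ 2 ∂P = v := by
  have h1 := variance_eq_sub (memLp_id_gaussianReal (μ := 0) (v := v) 2)
  rw [variance_id_gaussianReal] at h1
  simp only [id, integral_id_gaussianReal] at h1
  rw [h1, ← h]
  simp only [Pi.pow_apply]
  rw [integral_map hY.aemeasurable (by fun_prop)]
  simp

lemma integral_sq_linearCombination (hY : MemLp Y 2 P) (hZ : MemLp Z 2 P) (x y : ℝ) :
    ∫ ω, (x * Y ω + y * Z ω) ^ 2 ∂P =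
      (∫ ω, Y ω * Y ω ∂P) * x ^ 2 + 2 * (∫ ω, Y ω * Z ω ∂P) * x * y +
        (∫ ω, Z ω * Z ω ∂P) * y ^ 2 := by
  have hYY : Integrable (fun ω => Y ω * Y ω) P := hY.integrable_mul hY
  have hYZ : Integrable (fun ω => Y ω * Z ω) P := hY.integrable_mul hZ
  have hZZ : Integrable (fun ω => Z ω * Z ω) P := hZ.integrable_mul hZ
  have h (ω : Ω) : (x * Y ω + y * Z ω) ^ 2 =
      x ^ 2 * (Y ω * Y ω) + 2 * x * y * (Y ω * Z ω) + y ^ 2 * (Z ω * Z ω) := by ring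
  simp_rw [h]
  rw [integral_add (by fun_prop) (by fun_prop), integral_add (by fun_prop) (by fun_prop)]
  simp_rw [integral_const_mul]
  ring

lemma integral_cexp_of_map_eq_gaussianReal {v : NNReal} (hY : Measurable Y)
    (h : P.map Y = gaussianReal 0 v) :
    ∫ ω, Complex.exp (Complex.I * Y ω) ∂P = ((exp (-(∫ ω, Y ω ^ 2 ∂P) / 2) : ℝ) : ℂ) := by
  have h1 := charFun_gaussianReal (μ := 0) (v := v) 1
  rw [← h, charFun_apply_real, integral_map hY.aemeasurable (by fun_prop)] at h1
  rw [integral_sq_of_map_eq_gaussianReal hY h]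
  simp only [Complex.ofReal_one, one_mul, mul_comm _ Complex.I] at h1
  rw [h1]
  push_cast
  congr 1
  simp
  ring

/-- The product of Gaussian densities evaluated along a jointly Gaussian pair. -/
lemma integral_gaussian_density_mul [IsProbabilityMeasure P] (hY : Measurable Y) (hZ : Measurable Z)
    (hYZ : ∀ x y : ℝ, ∃ v : NNReal, P.map (fun ω => x * Y ω + y * Z ω) = gaussianReal 0 v)
    {ε θ : ℝ} (hε : 0 < ε) (hθ : 0 < θ) :
    ∫ ω, ((√(2 * π * ε))⁻¹ * exp (-Y ω ^ 2 / (2 * ε))) *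
        ((√(2 * π * θ))⁻¹ * exp (-Z ω ^ 2 / (2 * θ))) ∂P =
      1 / (2 * π) * (((∫ ω, Z ω * Z ω ∂P) + θ) * ((∫ ω, Y ω * Y ω ∂P) + ε) -
        (∫ ω, Y ω * Z ω ∂P) ^ 2) ^ (-(1:ℝ) / 2) := by
  have hY2 : MemLp Y 2 P := by
    obtain ⟨v, hv⟩ := hYZ 1 0
    exact memLp_two_of_map_eq_gaussianReal hY (by simpa using hv)
  have hZ2 : MemLp Z 2 P := by
    obtain ⟨v, hv⟩ := hYZ 0 1
    exact memLp_two_of_map_eq_gaussianReal hZ (by simpa using hv)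
  have hquad := integral_sq_linearCombination hY2 hZ2
  set a := ∫ ω, Y ω * Y ω ∂P with ha
  set b := ∫ ω, Y ω * Z ω ∂P with hb
  set c := ∫ ω, Z ω * Z ω ∂P with hc
  have hQ (x y : ℝ) : 0 ≤ a * x ^ 2 + 2 * b * x * y + c * y ^ 2 := by
    rw [← hquad]
    exact integral_nonneg fun ω => sq_nonneg _
  have ha0 : 0 ≤ a := by simpa using hQ 1 0
  have hc0 : 0 ≤ c := by simpa using hQ 0 1
  have hCS : b ^ 2 ≤ a * c := by
    have := discrim_le_zero (a := a) (b := 2 * b) (c := c) fun x => by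
      have := hQ x 1
      nlinarith
    rw [discrim] at this
    linarith
  have hdet : 0 < (a + ε) * (c + θ) - b ^ 2 := by
    nlinarith [mul_pos hε hθ, mul_nonneg ha0 hθ.le, mul_nonneg hε.le hc0]
  have hfour (ω : Ω) : ((((√(2 * π * ε))⁻¹ * exp (-Y ω ^ 2 / (2 * ε))) *
      ((√(2 * π * θ))⁻¹ * exp (-Z ω ^ 2 / (2 * θ))) : ℝ) : ℂ) =
      (2 * π : ℂ)⁻¹ ^ 2 * ∫ z : ℝ × ℝ, Complex.exp (Complex.I * ((z.1 * Y ω + z.2 * Z ω : ℝ) : ℂ)) *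
        ((exp (-(ε / 2) * z.1 ^ 2) * exp (-(θ / 2) * z.2 ^ 2) : ℝ) : ℂ) := by
    rw [Complex.ofReal_mul, gaussian_density_eq_fourier hε, gaussian_density_eq_fourier hθ,
      mul_mul_mul_comm, ← sq, ← integral_prod_mul, ← Measure.volume_eq_prod]
    congr 1
    refine integral_congr_ae (ae_of_all _ fun z => ?_)
    simp only
    push_cast
    simp only [← Complex.exp_add]
    congr 1
    ring
  have hF : Integrable (Function.uncurry fun (ω : Ω) (z : ℝ × ℝ) =>
      Complex.exp (Complex.I * ((z.1 * Y ω + z.2 * Z ω : ℝ) : ℂ)) *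
        ((exp (-(ε / 2) * z.1 ^ 2) * exp (-(θ / 2) * z.2 ^ 2) : ℝ) : ℂ)) (P.prod volume) := by
    have h1 : Integrable (fun z : ℝ × ℝ => exp (-(ε / 2) * z.1 ^ 2) * exp (-(θ / 2) * z.2 ^ 2)) :=
      (integrable_exp_neg_mul_sq (half_pos hε)).mul_prod (integrable_exp_neg_mul_sq (half_pos hθ))
    have h2 : Integrable (fun z : ℝ × ℝ =>
        ((exp (-(ε / 2) * z.1 ^ 2) * exp (-(θ / 2) * z.2 ^ 2) : ℝ) : ℂ)) := h1.ofReal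
    refine (h2.comp_snd P).bdd_mul (c := 1) ?_ (ae_of_all _ fun p => ?_)
    · exact Measurable.aestronglyMeasurable (by fun_prop)
    · rw [Complex.norm_exp_I_mul_ofReal]
  apply Complex.ofReal_injective
  rw [← integral_complex_ofReal]
  simp_rw [hfour]
  rw [integral_const_mul, integral_integral_swap hF]
  have hchar (z : ℝ × ℝ) : ∫ ω, Complex.exp (Complex.I * ((z.1 * Y ω + z.2 * Z ω : ℝ) : ℂ)) *
      ((exp (-(ε / 2) * z.1 ^ 2) * exp (-(θ / 2) * z.2 ^ 2) : ℝ) : ℂ) ∂P =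
      ((exp (-((a + ε) * z.1 ^ 2 + 2 * b * z.1 * z.2 + (c + θ) * z.2 ^ 2) / 2) : ℝ) : ℂ) := by
    obtain ⟨v, hv⟩ := hYZ z.1 z.2
    rw [integral_mul_const, integral_cexp_of_map_eq_gaussianReal (by fun_prop) hv, hquad,
      ← Complex.ofReal_mul, ← Real.exp_add, ← Real.exp_add]
    congr 2
    ring
  simp_rw [hchar]
  rw [integral_complex_ofReal, integral_exp_neg_quadForm (by positivity) (by positivity) hdet,
    mul_comm (c + θ)]
  push_cast
  field_simp

end GaussianPair

theorem stmt_7 {Ω : Type*} [MeasurableSpace Ω] (P : Measure Ω) [IsProbabilityMeasure P]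
    (α : ℝ → ℝ) (X : ℝ → Ω → ℝ)
    (hα_pos : ∀ t ≥ (0:ℝ), 0 < α t)
    (hα_cont : ContinuousOn α (Set.Ici 0))
    (hX : IsBridge P α X)
    (hmeas : Measurable (Function.uncurry X)) :
    ∀ t > (0:ℝ), ∀ ε > (0:ℝ), ∀ θ > (0:ℝ),
      ∫ ω, locApprox X 0 ε t ω * locApprox X 0 θ t ω ∂P =
        (1 / (2 * Real.pi)) * ∫ s in (0:ℝ)..t, ∫ r in (0:ℝ)..t,
          ((Kker α s s + θ) * (Kker α r r + ε) - (Kker α r s)^2) ^ (-(1:ℝ)/2) := by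
  intro t ht ε hε θ hθ
  set g : ℝ → ℝ → ℝ := fun ε x => (√(2 * π * ε))⁻¹ * exp (-x ^ 2 / (2 * ε)) with hg
  have hg_norm {ε : ℝ} (hε : 0 < ε) (x : ℝ) : ‖g ε x‖ ≤ (√(2 * π * ε))⁻¹ := by
    rw [Real.norm_eq_abs, abs_of_nonneg (by positivity)]
    refine mul_le_of_le_one_right (by positivity) (exp_le_one_iff.mpr ?_)
    rw [neg_div, neg_nonpos]
    positivity
  set μ : Measure ℝ := volume.restrict (Ioc 0 t)
  have hloc (ε : ℝ) (ω : Ω) : locApprox X 0 ε t ω = ∫ r, g ε (X r ω) ∂μ := by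
    simp only [locApprox, sub_zero]
    exact intervalIntegral.integral_of_le ht.le
  have hF : Integrable (Function.uncurry fun (ω : Ω) (p : ℝ × ℝ) =>
      g θ (X p.1 ω) * g ε (X p.2 ω)) (P.prod (μ.prod μ)) := by
    have h1 : Measurable fun q : Ω × ℝ × ℝ => X q.2.1 q.1 :=
      hmeas.comp (f := fun q : Ω × ℝ × ℝ => (q.2.1, q.1)) (by fun_prop)
    have h2 : Measurable fun q : Ω × ℝ × ℝ => X q.2.2 q.1 :=
      hmeas.comp (f := fun q : Ω × ℝ × ℝ => (q.2.2, q.1)) (by fun_prop)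
    refine Integrable.of_bound (C := (√(2 * π * θ))⁻¹ * (√(2 * π * ε))⁻¹)
      (Measurable.aestronglyMeasurable (by simp only [Function.uncurry_def, hg]; fun_prop))
      (ae_of_all _ fun q => ?_)
    rw [Function.uncurry_def, norm_mul]
    exact mul_le_mul (hg_norm hθ _) (hg_norm hε _) (norm_nonneg _) (by positivity)
  have hpair {s r : ℝ} (hs : 0 ≤ s) (hr : 0 ≤ r) :
      ∫ ω, g θ (X s ω) * g ε (X r ω) ∂P = 1 / (2 * π) *
        ((Kker α s s + θ) * (Kker α r r + ε) - (Kker α r s) ^ 2) ^ (-(1:ℝ) / 2) := by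
    have hm (u : ℝ) : Measurable (X u) := hmeas.comp measurable_prodMk_left
    rw [← hX.2 s s hs hs, ← hX.2 r r hr hr, ← hX.2 r s hr hs,
      ← integral_gaussian_density_mul (hm r) (hm s) _ hε hθ]
    · simp only [hg, mul_comm]
    · intro x y
      simpa [Fin.sum_univ_two] using
        hX.1 2 ![x, y] ![r, s] (by simp [Fin.forall_fin_two, hr, hs])
  calc ∫ ω, locApprox X 0 ε t ω * locApprox X 0 θ t ω ∂P
      = ∫ ω, ∫ p : ℝ × ℝ, g θ (X p.1 ω) * g ε (X p.2 ω) ∂(μ.prod μ) ∂P := by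
        refine integral_congr_ae (ae_of_all _ fun ω => ?_)
        simp only
        rw [integral_prod_mul (fun s => g θ (X s ω)) (fun r => g ε (X r ω)), hloc, hloc, mul_comm]
    _ = ∫ s, ∫ r, (∫ ω, g θ (X s ω) * g ε (X r ω) ∂P) ∂μ ∂μ := by
        rw [integral_integral_swap hF]
        exact integral_prod _ hF.integral_prod_right
    _ = 1 / (2 * π) * ∫ s, ∫ r, ((Kker α s s + θ) * (Kker α r r + ε) -
          (Kker α r s) ^ 2) ^ (-(1:ℝ) / 2) ∂μ ∂μ := by
        rw [← integral_const_mul]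
        refine setIntegral_congr_fun measurableSet_Ioc fun s hs => ?_
        rw [← integral_const_mul]
        exact setIntegral_congr_fun measurableSet_Ioc fun r hr => hpair hs.1.le hr.1.le
    _ = _ := by
        rw [intervalIntegral.integral_of_le ht.le]
        simp_rw [intervalIntegral.integral_of_le ht.le]
        rfl
end
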